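/- Let (F_p)_{p∈P} be a family of C^r-skew-products satisfying assumptions (U) and (T), with Δ(p) > N for every p in the closure of P. Fix p₀ ∈ P, 𝔞 ∈ 𝒜^ℕ and 𝔞₀ ∈ 𝒜^ℕ, and let μ be a Borel probability measure on 𝒜^{ℤ₋*} for which there exist constants 0 < c ≤ C' with c·Λ_{p₀,𝔞₀,ρ}^{Δ(p₀)} ≤ μ[ρ] ≤ C'·Λ_{p₀,𝔞₀,ρ}^{Δ(p₀)} for every finite word ρ ∈ 𝒜^*, where [ρ] denotes the cylinder of backward sequences ending with ρ. Let ν_{p,𝔞} be the pushforward of μ by π_{p,𝔞}. Then there exists δ > 0 such that the ball B of center p₀ and radius δ is contained in P and: (1) the integral I := ∫_{p∈B} ∫_{x∈ℝ^N} liminf_{r→0⁺} ν_{p,𝔞}(x + B(r))/(c_N r^N) dν_{p,𝔞}(x) dLeb_d(p) is finite, where B(r) ⊂ ℝ^N is the ball of center 0 and radius r and c_N r^N = Leb_N(B(r)); and (2) there exists θ₀ > 0 such that for every parameterized family 𝔽 of θ₀-U-perturbations, with ν_{t,p,𝔞} the pushforward of μ by π̃_{t,p,𝔞}, the integral I' :=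 ∫_{p∈B} ∫_{t∈T} ∫_{x∈ℝ^N} liminf_{r→0⁺} ν_{t,p,𝔞}(x + B(r))/(c_N r^N) dν_{t,p,𝔞}(x) dLeb_τ(t) dLeb_d(p) is finite. -/

import Mathlib

open Filter MeasureTheory Set
open scoped Topology ENNReal NNReal

noncomputable section

namespace Paper

abbrev E (n : ℕ) : Type := EuclideanSpace ℝ (Fin n)

def cube (N : ℕ) : Set (E N) := {x | ∀ i, x i ∈ Icc (-1:ℝ) 1}

def cubeO (d : ℕ) : Set (E d) := {p | ∀ i, p i ∈ Ioo (-1:ℝ) 1}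

variable {A : Type}

def consF (a : A) (𝔞 : ℕ → A) : ℕ → A := fun n =>
  match n with
  | 0 => a
  | Nat.succ k => 𝔞 k

def app : List A → (ℕ → A) → ℕ → A
  | [], 𝔞 => 𝔞
  | a :: w, 𝔞 => app w (consF a 𝔞)

def trunc (α : ℕ → A) (n : ℕ) : List A := List.ofFn fun i : Fin n => α i

def cyl (w : List A) : Set (ℕ → A) := {α | ∀ i : Fin w.length, α i = w.get i}

variable {N d : ℕ}

def psi (f : E d → (ℕ → A) → E N → E N) (p : E d) : List A → (ℕ → A) → E N → E N
  | [], _ => id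
  | a :: w, 𝔞 => f p (consF a 𝔞) ∘ psi f p w (consF a 𝔞)

def dentry (g : E N → E N) (x : E N) (i j : Fin N) : ℝ :=
  fderiv ℝ g x (EuclideanSpace.single j (1:ℝ)) i

def lam (hN : 0 < N) (f : E d → (ℕ → A) → E N → E N) (p : E d) (𝔞 : ℕ → A)
    (w : List A) (x : E N) : ℝ :=
  |dentry (psi f p w 𝔞) x ⟨0, hN⟩ ⟨0, hN⟩|

def Lam (hN : 0 < N) (f : E d → (ℕ → A) → E N → E N) (p : E d) (𝔞 : ℕ → A)
    (w : List A) : ℝ :=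
  sSup ((fun x => lam hN f p 𝔞 w x) '' cube N)

def piProj (f : E d → (ℕ → A) → E N → E N) (p : E d) (𝔞 α : ℕ → A) : E N :=
  limUnder atTop fun n => psi f p (trunc α n) 𝔞 0

def Mop (g : E N → E N) : ℝ := sSup ((fun x => ‖fderiv ℝ g x‖) '' cube N)

def pressure [Fintype A] (f : E d → (ℕ → A) → E N → E N) (p : E d) (𝔞 : ℕ → A) (s : ℝ) : ℝ :=
  limUnder atTop fun n : ℕ =>
    (1 / n : ℝ) * Real.log (∑ w : Fin n → A, Mop (psi f p (List.ofFn w) 𝔞) ^ s)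

structure SkewFamily (A : Type) (N d : ℕ) (r : ℕ∞) where
  f : E d → (ℕ → A) → E N → E N
  X' : Set (E N)
  P' : Set (E d)
  X'_open : IsOpen X'
  X_subset : cube N ⊆ X'
  P'_open : IsOpen P'
  P_subset : closure (cubeO d) ⊆ P'
  smooth : ∀ 𝔞 : ℕ → A, ContDiffOn ℝ r (fun q : E d × E N => f q.1 𝔞 q.2) (P' ×ˢ X')
  inj : ∀ 𝔞 : ℕ → A, ∀ p ∈ P', Set.InjOn (f p 𝔞) X'
  into : ∀ 𝔞 : ℕ → A, ∀ p ∈ P', f p 𝔞 '' X' ⊆ cube N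
  holder0 : ∃ C > (0:ℝ), ∃ θ ∈ Set.Ioo (0:ℝ) 1, ∀ p ∈ P', ∀ (𝔞 𝔟 : ℕ → A) (q : ℕ),
      (∀ i < q, 𝔞 i = 𝔟 i) → ∀ x ∈ X', ‖f p 𝔞 x - f p 𝔟 x‖ ≤ C * θ ^ q
  holder1 : ∃ C > (0:ℝ), ∃ θ ∈ Set.Ioo (0:ℝ) 1, ∀ p ∈ P', ∀ (𝔞 𝔟 : ℕ → A) (q : ℕ),
      (∀ i < q, 𝔞 i = 𝔟 i) → ∀ x ∈ X',
      ‖fderiv ℝ (f p 𝔞) x - fderiv ℝ (f p 𝔟) x‖ ≤ C * θ ^ q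
  cont2 : ∀ p ∈ P', ∀ 𝔞 : ℕ → A, ∀ ε > (0:ℝ), ∃ q : ℕ, ∀ 𝔟 : ℕ → A,
      (∀ i < q, 𝔞 i = 𝔟 i) → ∀ x ∈ X',
      ‖iteratedFDeriv ℝ 2 (f p 𝔞) x - iteratedFDeriv ℝ 2 (f p 𝔟) x‖ ≤ ε

def UnipOn (hN : 0 < N) (f : E d → (ℕ → A) → E N → E N)
    (P' : Set (E d)) (X' : Set (E N)) : Prop :=
  ∀ p ∈ P', ∀ 𝔞 : ℕ → A, ∀ x ∈ X',
    (∀ i j : Fin N, (i : ℕ) < (j : ℕ) → dentry (f p 𝔞) x i j = 0) ∧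
    (∀ i j : Fin N, dentry (f p 𝔞) x i i = dentry (f p 𝔞) x j j) ∧
    0 < |dentry (f p 𝔞) x ⟨0, hN⟩ ⟨0, hN⟩| ∧ |dentry (f p 𝔞) x ⟨0, hN⟩ ⟨0, hN⟩| < 1

def GammaBounds (hN : 0 < N) (f : E d → (ℕ → A) → E N → E N) (γ' γ : ℝ) : Prop :=
  0 < γ' ∧ γ' < γ ∧ γ < 1 ∧
  ∀ p ∈ closure (cubeO d), ∀ (𝔞 : ℕ → A) (a : A), ∀ x ∈ cube N,
    γ' < lam hN f p 𝔞 [a] x ∧ lam hN f p 𝔞 [a] x < γ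

structure ParamPerturb {A : Type} {N d : ℕ} {r : ℕ∞} (hN : 0 < N)
    (S : SkewFamily A N d r) (θ : ℝ) (τ : ℕ) where
  g : E τ → E d → (ℕ → A) → E N → E N
  jointSmooth : ∀ 𝔞 : ℕ → A, ContDiffOn ℝ r
      (fun q : E τ × E d × E N => g q.1 q.2.1 𝔞 q.2.2) ((cubeO τ) ×ˢ S.P' ×ˢ S.X')
  smooth : ∀ t ∈ cubeO τ, ∀ 𝔞 : ℕ → A, ContDiffOn ℝ r
      (fun q : E d × E N => g t q.1 𝔞 q.2) (S.P' ×ˢ S.X')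
  inj : ∀ t ∈ cubeO τ, ∀ 𝔞 : ℕ → A, ∀ p ∈ S.P', Set.InjOn (g t p 𝔞) S.X'
  into : ∀ t ∈ cubeO τ, ∀ 𝔞 : ℕ → A, ∀ p ∈ S.P', g t p 𝔞 '' S.X' ⊆ cube N
  close : ∃ θ' < θ, ∀ t ∈ cubeO τ, ∀ (𝔞 : ℕ → A) (k : ℕ), (k : ℕ∞) ≤ r →
      ∀ p ∈ S.P', ∀ x ∈ S.X',
      ‖iteratedFDeriv ℝ k (fun q : E d × E N => S.f q.1 𝔞 q.2 - g t q.1 𝔞 q.2) (p, x)‖ ≤ θ'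
  unip : ∀ t ∈ cubeO τ, UnipOn hN (g t) S.P' S.X'

def TransAssumption {A : Type} {N d : ℕ} {r : ℕ∞} (hN : 0 < N)
    (S : SkewFamily A N d r) : Prop :=
  ∃ C > (0:ℝ),
    (∀ 𝔞 α β : ℕ → A, α 0 ≠ β 0 → ∀ rr > (0:ℝ),
      volume {p ∈ cubeO d | ‖piProj S.f p 𝔞 α - piProj S.f p 𝔞 β‖ < rr}
        ≤ ENNReal.ofReal (C * rr ^ N)) ∧
    ∃ θ₀ > (0:ℝ), ∀ θ : ℝ, 0 < θ → θ ≤ θ₀ → ∀ τ : ℕ, 0 < τ →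
      ∀ Ft : ParamPerturb hN S θ τ, ∀ t ∈ cubeO τ,
      ∀ 𝔞 α β : ℕ → A, α 0 ≠ β 0 → ∀ rr > (0:ℝ),
        volume {p ∈ cubeO d | ‖piProj (Ft.g t) p 𝔞 α - piProj (Ft.g t) p 𝔞 β‖ < rr}
          ≤ ENNReal.ofReal (C * rr ^ N)

def dens {N : ℕ} (ν : Measure (E N)) (x : E N) : ℝ≥0∞ :=
  liminf (fun rr : ℝ => ν (Metric.ball x rr) / volume (Metric.ball (0 : E N) rr)) (𝓝[>] (0:ℝ))

end Paper

namespace IFS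

open Paper

variable {A : Type}

def psiA (c b : ℝ → A → ℝ) (p : ℝ) : List A → ℝ → ℝ
  | [], x => x
  | a :: w, x => c p a * psiA c b p w x + b p a

def piA (c b : ℝ → A → ℝ) (p : ℝ) (α : ℕ → A) : ℝ :=
  limUnder atTop fun n => psiA c b p (Paper.trunc α n) 0

def LamA (c : ℝ → A → ℝ) (p : ℝ) (w : List A) : ℝ := (w.map fun a => |c p a|).prod

def IFSHyp (c b : ℝ → A → ℝ) (U : Set ℝ) : Prop :=
  IsOpen U ∧ Icc (-1:ℝ) 1 ⊆ U ∧
  (∀ a : A, ContinuousOn (fun p => c p a) U) ∧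
  (∀ a : A, ContinuousOn (fun p => b p a) U) ∧
  (∀ p ∈ U, ∀ a : A, ∀ x ∈ Icc (-1:ℝ) 1, c p a * x + b p a ∈ Ioo (-1:ℝ) 1)

def GammaBoundsA (c : ℝ → A → ℝ) (γ' γ : ℝ) : Prop :=
  0 < γ' ∧ γ' < γ ∧ γ < 1 ∧ ∀ p ∈ Icc (-1:ℝ) 1, ∀ a : A, γ' < |c p a| ∧ |c p a| < γ

def TransAff (c b : ℝ → A → ℝ) : Prop :=
  ∃ C > (0:ℝ), ∀ α β : ℕ → A, α 0 ≠ β 0 → ∀ rr > (0:ℝ),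
    volume {p ∈ Ioo (-1:ℝ) 1 | |piA c b p α - piA c b p β| < rr} ≤ ENNReal.ofReal (C * rr)

def densR (ν : MeasureTheory.Measure ℝ) (x : ℝ) : ℝ≥0∞ :=
  liminf (fun rr : ℝ => ν (Ioo (x - rr) (x + rr)) / ENNReal.ofReal (2 * rr)) (𝓝[>] (0:ℝ))

end IFS

namespace Paper


/-- weighted coordinates -/
def DD (N : ℕ) (η : ℝ) : E N →L[ℝ] (Fin N → ℝ) :=
  ContinuousLinearMap.pi (fun i => (η ^ (i:ℕ)) • (EuclideanSpace.proj i : E N →L[ℝ] ℝ))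

lemma DD_apply {N : ℕ} (η : ℝ) (v : E N) (i : Fin N) : DD N η v i = η ^ (i:ℕ) * v i := by
  simp [DD]

lemma coord_le_norm {N : ℕ} (v : E N) (i : Fin N) : |v i| ≤ ‖v‖ := by
  simpa using PiLp.norm_apply_le v i

lemma DD_le {N : ℕ} {η : ℝ} (h0 : 0 ≤ η) (h1 : η ≤ 1) (v : E N) : ‖DD N η v‖ ≤ ‖v‖ := by
  refine (pi_norm_le_iff_of_nonneg (norm_nonneg _)).2 fun i => ?_
  rw [DD_apply, Real.norm_eq_abs, abs_mul, abs_of_nonneg (pow_nonneg h0 _)]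
  have := coord_le_norm v i
  have h2 := pow_le_one₀ (n := (i:ℕ)) h0 h1
  have h3 := pow_nonneg h0 (i:ℕ)
  nlinarith [abs_nonneg (v i)]

lemma le_DD {N : ℕ} {η : ℝ} (h0 : 0 < η) : ∃ c > (0:ℝ), ∀ v : E N, c * ‖v‖ ≤ ‖DD N η v‖ := by
  have hk : (DD N η : E N →ₗ[ℝ] (Fin N → ℝ)).ker = ⊥ := by
    rw [LinearMap.ker_eq_bot']
    intro v hv
    ext i
    have := congrFun hv i
    rw [ContinuousLinearMap.coe_coe, DD_apply] at this
    simpa [h0.ne'] using this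
  obtain ⟨K, hK, hA⟩ := LinearMap.exists_antilipschitzWith _ hk
  refine ⟨(K:ℝ)⁻¹, by positivity, fun v => ?_⟩
  have := hA.le_mul_dist v 0
  simp only [dist_zero_right, map_zero, ContinuousLinearMap.coe_coe] at this
  rw [inv_mul_le_iff₀ (by exact_mod_cast hK)]
  exact this

lemma DD_coord {N : ℕ} {η : ℝ} (v : E N) (h0 : 0 ≤ η) (i : Fin N) :
    η ^ (i:ℕ) * |v i| ≤ ‖DD N η v‖ := by
  have := norm_le_pi_norm (DD N η v) i
  rwa [DD_apply, Real.norm_eq_abs, abs_mul, abs_of_nonneg (pow_nonneg h0 _)] at this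

lemma DD_cube {N : ℕ} {η : ℝ} (h0 : 0 ≤ η) (h1 : η ≤ 1) {x y : E N} (hx : x ∈ cube N)
    (hy : y ∈ cube N) : ‖DD N η (x - y)‖ ≤ 2 := by
  refine (pi_norm_le_iff_of_nonneg (by norm_num)).2 fun i => ?_
  rw [DD_apply, Real.norm_eq_abs, abs_mul, abs_of_nonneg (pow_nonneg h0 _)]
  have h2 := pow_le_one₀ (n := (i:ℕ)) h0 h1
  have h3 := pow_nonneg h0 (i:ℕ)
  have h4 : |(x - y) i| ≤ 2 := by
    have := hx i; have := hy i
    simp only [mem_Icc] at *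
    rw [PiLp.sub_apply, abs_le]; constructor <;> linarith
  nlinarith [abs_nonneg ((x - y) i)]

lemma cube_convex (N : ℕ) : Convex ℝ (cube N) := by
  intro x hx y hy a b ha hb hab i
  have := hx i; have := hy i
  simp only [mem_Icc, PiLp.add_apply, PiLp.smul_apply, smul_eq_mul] at *
  constructor <;> nlinarith

lemma cube_closed (N : ℕ) : IsClosed (cube N) := by
  have : cube N = ⋂ i, {x : E N | x i ∈ Icc (-1:ℝ) 1} := by ext; simp [cube]
  rw [this]
  exact isClosed_iInter fun i => isClosed_Icc.preimage (by fun_prop)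

lemma cube_bdd (N : ℕ) : ∃ R : ℝ, ∀ x ∈ cube N, ‖x‖ ≤ R := by
  obtain ⟨c, hc, h⟩ := le_DD (N := N) (η := 1) one_pos
  refine ⟨2 / c, fun x hx => ?_⟩
  rw [le_div_iff₀ hc, mul_comm]
  refine (h x).trans ?_
  have := DD_cube (η := 1) (by norm_num) le_rfl hx (show (0 : E N) ∈ cube N by intro i; simp)
  simpa using this

lemma zero_mem_cube (N : ℕ) : (0 : E N) ∈ cube N := by intro i; simp

lemma cube_compact (N : ℕ) : IsCompact (cube N) := by
  obtain ⟨R, hR⟩ := cube_bdd N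
  exact (isCompact_closedBall (0 : E N) R).of_isClosed_subset (cube_closed N)
    (fun x hx => by simpa using hR x hx)

lemma cubeO_open (d : ℕ) : IsOpen (cubeO d) := by
  have : cubeO d = ⋂ i, {x : E d | x i ∈ Ioo (-1:ℝ) 1} := by ext; simp [cubeO]
  rw [this]
  exact isOpen_iInter_of_finite fun i => isOpen_Ioo.preimage (by fun_prop)

lemma cubeO_sub (d : ℕ) : cubeO d ⊆ cube d := fun _ hx i => Ioo_subset_Icc_self (hx i)

lemma clm_coord {N : ℕ} (L : E N →L[ℝ] E N) (v : E N) (i : Fin N) :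
    (L v) i = ∑ j, v j * (L (EuclideanSpace.single j (1:ℝ))) i := by
  have hv : v = ∑ j, v j • EuclideanSpace.single j (1:ℝ) := by
    ext k
    simp [Finset.sum_apply, Pi.single_apply]
  conv_lhs => rw [hv, map_sum]
  simp [Finset.sum_apply]

lemma tri_row {N : ℕ} {η M : ℝ} (h0 : 0 ≤ η) (h1 : η ≤ 1) (L : E N →L[ℝ] E N) (ℓ : ℝ)
    (hM : ‖L‖ ≤ M)
    (hU : ∀ i j : Fin N, (i:ℕ) < (j:ℕ) → L (EuclideanSpace.single j (1:ℝ)) i = 0)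
    (hD : ∀ i, L (EuclideanSpace.single i (1:ℝ)) i = ℓ) (v : E N) (i : Fin N) :
    η ^ (i:ℕ) * |(L v) i - ℓ * v i| ≤ N * M * η * ‖DD N η v‖ := by
  have hM0 : 0 ≤ M := (norm_nonneg _).trans hM
  have e : (L v) i - ℓ * v i
      = ∑ j ∈ Finset.univ.erase i, v j * (L (EuclideanSpace.single j (1:ℝ))) i := by
    rw [clm_coord, ← Finset.add_sum_erase _ _ (Finset.mem_univ i), hD]; ring
  rw [e]
  have hb : ∀ j ∈ Finset.univ.erase i,
      η ^ (i:ℕ) * |v j * (L (EuclideanSpace.single j (1:ℝ))) i| ≤ M * η * ‖DD N η v‖ := by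
    intro j hj
    have hne : j ≠ i := Finset.ne_of_mem_erase hj
    rcases lt_or_ge (i:ℕ) (j:ℕ) with h | h
    · rw [hU i j h]; simp; positivity
    · have hlt : (j:ℕ) < i := lt_of_le_of_ne h (fun h => hne (Fin.ext h))
      have hp : η ^ (i:ℕ) ≤ η * η ^ (j:ℕ) := by
        rw [← pow_succ']
        exact pow_le_pow_of_le_one h0 h1 hlt
      have hL : |(L (EuclideanSpace.single j (1:ℝ))) i| ≤ M := by
        refine (coord_le_norm _ _).trans ((L.le_opNorm _).trans ?_)
        simpa using hM
      have hc := DD_coord v h0 j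
      rw [abs_mul]
      calc η ^ (i:ℕ) * (|v j| * |(L (EuclideanSpace.single j (1:ℝ))) i|)
          ≤ (η * η ^ (j:ℕ)) * (|v j| * M) := by gcongr
        _ = M * η * (η ^ (j:ℕ) * |v j|) := by ring
        _ ≤ _ := by gcongr
  calc η ^ (i:ℕ) * |∑ j ∈ Finset.univ.erase i, v j * (L (EuclideanSpace.single j (1:ℝ))) i|
      ≤ η ^ (i:ℕ) * ∑ j ∈ Finset.univ.erase i, |v j * (L (EuclideanSpace.single j (1:ℝ))) i| := by
        gcongr; exact Finset.abs_sum_le_sum_abs _ _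
    _ = ∑ j ∈ Finset.univ.erase i, η ^ (i:ℕ) * |v j * (L (EuclideanSpace.single j (1:ℝ))) i| := by
        rw [Finset.mul_sum]
    _ ≤ ∑ j ∈ Finset.univ.erase i, M * η * ‖DD N η v‖ := Finset.sum_le_sum hb
    _ ≤ ∑ j : Fin N, M * η * ‖DD N η v‖ := by
        apply Finset.sum_le_sum_of_subset_of_nonneg (Finset.erase_subset _ _)
        intros; positivity
    _ = _ := by simp; ring

/-- coordinatewise mean value property -/
def MV {A : Type} {N : ℕ} (η ε : ℝ) (G : (ℕ → A) → E N → E N) (ℓ : (ℕ → A) → E N → ℝ) : Prop :=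
  ∀ 𝔟 : ℕ → A, ∀ x ∈ cube N, ∀ y ∈ cube N, ∀ i : Fin N, ∃ u ∈ segment ℝ x y,
    η ^ (i:ℕ) * |(G 𝔟 x - G 𝔟 y) i - ℓ 𝔟 u * (x - y) i| ≤ ε * ‖DD N η (x - y)‖

lemma MV_of {A : Type} {N : ℕ} {η ε M e c : ℝ} (h0 : 0 < η) (h1 : η ≤ 1)
    (hc : 0 < c) (hcD : ∀ v : E N, c * ‖v‖ ≤ ‖DD N η v‖)
    (F G : (ℕ → A) → E N → E N) (ℓ : (ℕ → A) → E N → ℝ)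
    (hd : ∀ 𝔟, ∀ x ∈ cube N, DifferentiableAt ℝ (G 𝔟) x)
    (hM : ∀ 𝔟, ∀ x ∈ cube N, ‖fderiv ℝ (F 𝔟) x‖ ≤ M)
    (hU : ∀ 𝔟, ∀ x ∈ cube N, ∀ i j : Fin N, (i:ℕ) < (j:ℕ) → dentry (F 𝔟) x i j = 0)
    (hD : ∀ 𝔟, ∀ x ∈ cube N, ∀ i, dentry (F 𝔟) x i i = ℓ 𝔟 x)
    (hcl : ∀ 𝔟, ∀ x ∈ cube N, ‖fderiv ℝ (F 𝔟) x - fderiv ℝ (G 𝔟) x‖ ≤ e)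
    (hε : N * M * η + e / c ≤ ε) : MV η ε G ℓ := by
  intro 𝔟 x hx y hy i
  obtain ⟨u, hu, hu2⟩ := domain_mvt (f := fun z => G 𝔟 z i) (s := cube N) (x := y) (y := x)
    (f' := fun z => (EuclideanSpace.proj i : E N →L[ℝ] ℝ).comp (fderiv ℝ (G 𝔟) z))
    (fun z hz => (((EuclideanSpace.proj i : E N →L[ℝ] ℝ).hasFDerivAt).comp z
      (hd 𝔟 z hz).hasFDerivAt).hasFDerivWithinAt) (cube_convex N) hy hx
  refine ⟨u, by rwa [segment_symm], ?_⟩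
  have huc : u ∈ cube N := (cube_convex N).segment_subset hy hx hu
  have e1 : (G 𝔟 x - G 𝔟 y) i = (fderiv ℝ (G 𝔟) u (x - y)) i := by
    simpa using hu2
  rw [e1]
  set v := x - y
  have t1 := tri_row h0.le h1 (fderiv ℝ (F 𝔟) u) (ℓ 𝔟 u) (hM 𝔟 u huc) (hU 𝔟 u huc)
    (hD 𝔟 u huc) v i
  have he : 0 ≤ e := (norm_nonneg _).trans (hcl 𝔟 u huc)
  have t2 : |(fderiv ℝ (F 𝔟) u v) i - (fderiv ℝ (G 𝔟) u v) i| ≤ e / c * ‖DD N η v‖ := by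
    have a1 := coord_le_norm ((fderiv ℝ (F 𝔟) u - fderiv ℝ (G 𝔟) u) v) i
    have a2 := (fderiv ℝ (F 𝔟) u - fderiv ℝ (G 𝔟) u).le_opNorm v
    have a3 : ‖v‖ ≤ ‖DD N η v‖ / c := by rw [le_div_iff₀ hc, mul_comm]; exact hcD v
    calc _ ≤ _ := a1
      _ ≤ _ := a2
      _ ≤ e * (‖DD N η v‖ / c) := by gcongr; exact hcl 𝔟 u huc
      _ = _ := by ring
  have h2 := pow_le_one₀ (n := (i:ℕ)) h0.le h1
  have h3 := pow_nonneg h0.le (i:ℕ)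
  have t3 : |(fderiv ℝ (G 𝔟) u v) i - ℓ 𝔟 u * v i| ≤
      |(fderiv ℝ (F 𝔟) u v) i - ℓ 𝔟 u * v i| +
      |(fderiv ℝ (F 𝔟) u v) i - (fderiv ℝ (G 𝔟) u v) i| := by
    rw [abs_sub_comm ((fderiv ℝ (F 𝔟) u v) i) ((fderiv ℝ (G 𝔟) u v) i), add_comm]
    exact abs_sub_le _ _ _
  calc _ ≤ η ^ (i:ℕ) * (|(fderiv ℝ (F 𝔟) u v) i - ℓ 𝔟 u * v i| +
      |(fderiv ℝ (F 𝔟) u v) i - (fderiv ℝ (G 𝔟) u v) i|) := by gcongr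
    _ = η ^ (i:ℕ) * |(fderiv ℝ (F 𝔟) u v) i - ℓ 𝔟 u * v i| +
      η ^ (i:ℕ) * |(fderiv ℝ (F 𝔟) u v) i - (fderiv ℝ (G 𝔟) u v) i| := by ring
    _ ≤ N * M * η * ‖DD N η v‖ + 1 * (e / c * ‖DD N η v‖) := by gcongr
    _ = (N * M * η + e / c) * ‖DD N η v‖ := by ring
    _ ≤ _ := by gcongr

lemma MV.contr {A : Type} {N : ℕ} {η ε γ : ℝ} {G : (ℕ → A) → E N → E N} {ℓ : (ℕ → A) → E N → ℝ}
    (h : MV η ε G ℓ) (h0 : 0 ≤ η) (hε : 0 ≤ ε) (hγ0 : 0 ≤ γ) (hℓ : ∀ 𝔟, ∀ x ∈ cube N, |ℓ 𝔟 x| ≤ γ)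
    (𝔟 : ℕ → A) {x y : E N} (hx : x ∈ cube N) (hy : y ∈ cube N) :
    ‖DD N η (G 𝔟 x - G 𝔟 y)‖ ≤ (γ + ε) * ‖DD N η (x - y)‖ := by
  refine (pi_norm_le_iff_of_nonneg (by positivity)).2 fun i => ?_
  rw [DD_apply, Real.norm_eq_abs, abs_mul, abs_of_nonneg (pow_nonneg h0 _)]
  obtain ⟨u, hu, hu2⟩ := h 𝔟 x hx y hy i
  have huc : u ∈ cube N := (cube_convex N).segment_subset hx hy hu
  have h3 := pow_nonneg h0 (i:ℕ)
  have hc := DD_coord (x - y) h0 i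
  have : |(G 𝔟 x - G 𝔟 y) i| ≤ |(G 𝔟 x - G 𝔟 y) i - ℓ 𝔟 u * (x - y) i| + γ * |(x - y) i| := by
    calc _ = |((G 𝔟 x - G 𝔟 y) i - ℓ 𝔟 u * (x - y) i) + ℓ 𝔟 u * (x - y) i| := by ring_nf
      _ ≤ _ := abs_add_le _ _
      _ ≤ _ := by rw [abs_mul (ℓ 𝔟 u)]; gcongr; exact hℓ 𝔟 u huc
  calc _ ≤ η ^ (i:ℕ) * (|(G 𝔟 x - G 𝔟 y) i - ℓ 𝔟 u * (x - y) i| + γ * |(x - y) i|) := by gcongr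
    _ = η ^ (i:ℕ) * |(G 𝔟 x - G 𝔟 y) i - ℓ 𝔟 u * (x - y) i| + γ * (η ^ (i:ℕ) * |(x - y) i|) := by
      ring
    _ ≤ ε * ‖DD N η (x - y)‖ + γ * ‖DD N η (x - y)‖ := by gcongr
    _ = _ := by ring

lemma MV.expand {A : Type} {N : ℕ} (hN : 0 < N) {η ε : ℝ} {G : (ℕ → A) → E N → E N}
    {ℓ : (ℕ → A) → E N → ℝ}
    (h : MV η ε G ℓ) (h0 : 0 ≤ η)
    (𝔟 : ℕ → A) {x y : E N} (hx : x ∈ cube N) (hy : y ∈ cube N) :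
    ∃ u ∈ segment ℝ x y, (|ℓ 𝔟 u| - ε) * ‖DD N η (x - y)‖ ≤ ‖DD N η (G 𝔟 x - G 𝔟 y)‖ := by
  have : Nonempty (Fin N) := ⟨⟨0, hN⟩⟩
  obtain ⟨i, hi⟩ := Finite.exists_max (fun i : Fin N => η ^ (i:ℕ) * |(x - y) i|)
  have hmax : ‖DD N η (x - y)‖ = η ^ (i:ℕ) * |(x - y) i| := by
    apply le_antisymm
    · refine (pi_norm_le_iff_of_nonneg (by positivity)).2 fun j => ?_
      rw [DD_apply, Real.norm_eq_abs, abs_mul, abs_of_nonneg (pow_nonneg h0 _)]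
      exact hi j
    · exact DD_coord _ h0 i
  obtain ⟨u, hu, hu2⟩ := h 𝔟 x hx y hy i
  refine ⟨u, hu, ?_⟩
  have h3 := pow_nonneg h0 (i:ℕ)
  refine le_trans ?_ (DD_coord (G 𝔟 x - G 𝔟 y) h0 i)
  have : |ℓ 𝔟 u| * |(x - y) i| ≤
      |(G 𝔟 x - G 𝔟 y) i - ℓ 𝔟 u * (x - y) i| + |(G 𝔟 x - G 𝔟 y) i| := by
    rw [← abs_mul, ← abs_neg, add_comm]
    calc _ = |((G 𝔟 x - G 𝔟 y) i - ℓ 𝔟 u * (x - y) i) - (G 𝔟 x - G 𝔟 y) i| := by ring_nf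
      _ ≤ _ := abs_sub _ _
      _ = _ := add_comm _ _
  have := mul_le_mul_of_nonneg_left this h3
  rw [hmax] at hu2 ⊢
  linarith

lemma consF_agree {A : Type} {𝔟 𝔟₀ : ℕ → A} {q : ℕ} (h : ∀ i < q, 𝔟 i = 𝔟₀ i) (a : A) :
    ∀ i < q + 1, consF a 𝔟 i = consF a 𝔟₀ i := by
  intro i hi
  cases i with
  | zero => rfl
  | succ k => exact h k (by omega)

lemma psi_mem {A : Type} {N d : ℕ} {f : E d → (ℕ → A) → E N → E N} {p : E d}
    (hf : ∀ 𝔟, ∀ x ∈ cube N, f p 𝔟 x ∈ cube N) (w : List A) (𝔟 : ℕ → A) {x : E N}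
    (hx : x ∈ cube N) : psi f p w 𝔟 x ∈ cube N := by
  induction w generalizing 𝔟 with
  | nil => exact hx
  | cons a w ih => exact hf _ _ (ih _)

lemma dist_orbit {A : Type} {N d d' : ℕ} {f : E d → (ℕ → A) → E N → E N} {p : E d}
    {g : E d' → (ℕ → A) → E N → E N} {p' : E d'} {η κ ec C θ : ℝ}
    (h0 : 0 ≤ η) (h1 : η ≤ 1) (hκ0 : 0 ≤ κ) (hκ1 : κ < 1) (hec : 0 ≤ ec) (hC : 0 ≤ C)
    (hθ0 : 0 ≤ θ) (hθ1 : θ < 1)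
    (hf : ∀ 𝔟, ∀ x ∈ cube N, f p 𝔟 x ∈ cube N)
    (hg : ∀ 𝔟, ∀ x ∈ cube N, g p' 𝔟 x ∈ cube N)
    (hcon : ∀ 𝔟, ∀ x ∈ cube N, ∀ y ∈ cube N,
      ‖DD N η (f p 𝔟 x - f p 𝔟 y)‖ ≤ κ * ‖DD N η (x - y)‖)
    (hcl : ∀ 𝔟, ∀ x ∈ cube N, ‖DD N η (g p' 𝔟 x - f p 𝔟 x)‖ ≤ ec)
    (hho : ∀ (𝔟 𝔟₀ : ℕ → A) (q : ℕ), (∀ i < q, 𝔟 i = 𝔟₀ i) → ∀ x ∈ cube N,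
      ‖DD N η (f p 𝔟 x - f p 𝔟₀ x)‖ ≤ C * θ ^ q)
    (w : List A) (𝔟 𝔟₀ : ℕ → A) (q : ℕ) (hq : ∀ i < q, 𝔟 i = 𝔟₀ i) {x z : E N}
    (hx : x ∈ cube N) (hz : z ∈ cube N) :
    ‖DD N η (psi g p' w 𝔟 x - psi f p w 𝔟₀ z)‖ ≤
      2 * κ ^ w.length + ec / (1 - κ) + C / (1 - κ) * θ ^ q := by
  have hk : 0 < 1 - κ := by linarith
  induction w generalizing 𝔟 𝔟₀ q with
  | nil =>
    have := DD_cube h0 h1 hx hz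
    have : 0 ≤ ec / (1 - κ) + C / (1 - κ) * θ ^ q := by positivity
    simp only [psi, id, List.length_nil, pow_zero]
    linarith
  | cons a w ih =>
    have hq' := consF_agree hq a
    have i1 := ih _ _ _ hq'
    set x1 := psi g p' w (consF a 𝔟) x with hx1
    set z1 := psi f p w (consF a 𝔟₀) z with hz1
    have hx1c : x1 ∈ cube N := psi_mem hg _ _ hx
    have hz1c : z1 ∈ cube N := psi_mem hf _ _ hz
    have e : psi g p' (a :: w) 𝔟 x - psi f p (a :: w) 𝔟₀ z =
        (g p' (consF a 𝔟) x1 - f p (consF a 𝔟) x1) +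
        (f p (consF a 𝔟) x1 - f p (consF a 𝔟₀) x1) +
        (f p (consF a 𝔟₀) x1 - f p (consF a 𝔟₀) z1) := by
      simp only [psi, Function.comp, ← hx1, ← hz1]; abel
    rw [e, map_add, map_add]
    have a1 := hcl (consF a 𝔟) x1 hx1c
    have a2 := hho _ _ _ hq' x1 hx1c
    have a3 := hcon (consF a 𝔟₀) x1 hx1c z1 hz1c
    have a4 := mul_le_mul_of_nonneg_left i1 hκ0
    have a5 : θ ^ (q+1) ≤ θ ^ q := pow_le_pow_of_le_one hθ0 hθ1.le (by omega)
    have a6 : C / (1 - κ) * θ ^ (q+1) ≤ C / (1 - κ) * θ ^ q := by gcongr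
    have a7 : ec + κ * (ec / (1 - κ)) = ec / (1 - κ) := by field_simp; ring
    have a8 : C + κ * (C / (1 - κ)) = C / (1 - κ) := by field_simp; ring
    refine (norm_add₃_le).trans ?_
    rw [List.length_cons, pow_succ]
    have a9 : C * θ ^ (q+1) + κ * (C / (1 - κ) * θ ^ (q+1)) = C / (1 - κ) * θ ^ (q+1) := by
      linear_combination θ ^ (q+1) * a8
    nlinarith

/-- product of diagonal entries along the orbit -/
def ll {A : Type} {N d : ℕ} (ℓ : (ℕ → A) → E N → ℝ) (f : E d → (ℕ → A) → E N → E N) (p : E d) :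
    List A → (ℕ → A) → E N → ℝ
  | [], _, _ => 1
  | a :: w, 𝔞, z => |ℓ (consF a 𝔞) (psi f p w (consF a 𝔞) z)| * ll ℓ f p w (consF a 𝔞) z

lemma ll_bounds {A : Type} {N d : ℕ} {ℓ : (ℕ → A) → E N → ℝ} {f : E d → (ℕ → A) → E N → E N}
    {p : E d} {γ' γ : ℝ} (h' : 0 < γ')
    (hf : ∀ 𝔟, ∀ x ∈ cube N, f p 𝔟 x ∈ cube N)
    (hℓ : ∀ 𝔟, ∀ x ∈ cube N, γ' ≤ |ℓ 𝔟 x| ∧ |ℓ 𝔟 x| ≤ γ) (w : List A) (𝔟 : ℕ → A) {z : E N}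
    (hz : z ∈ cube N) : γ' ^ w.length ≤ ll ℓ f p w 𝔟 z ∧ ll ℓ f p w 𝔟 z ≤ γ ^ w.length := by
  induction w generalizing 𝔟 with
  | nil => simp [ll]
  | cons a w ih =>
    have i1 := ih (consF a 𝔟)
    have i2 := hℓ (consF a 𝔟) _ (psi_mem hf w (consF a 𝔟) hz)
    simp only [ll, List.length_cons, pow_succ']
    have : 0 < γ' ^ w.length := by positivity
    constructor
    · apply mul_le_mul i2.1 i1.1 this.le (abs_nonneg _)
    · apply mul_le_mul i2.2 i1.2 (this.le.trans i1.1) (h'.le.trans (i2.1.trans i2.2))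

lemma seg_bound {N : ℕ} {η b : ℝ} {x y z u : E N} (hu : u ∈ segment ℝ x y)
    (hx : ‖DD N η (x - z)‖ ≤ b) (hy : ‖DD N η (y - z)‖ ≤ b) : ‖DD N η (u - z)‖ ≤ b := by
  obtain ⟨s, t, hs, ht, hst, rfl⟩ := hu
  have : s • x + t • y - z = s • (x - z) + t • (y - z) := by
    have : z = (s + t) • z := by rw [hst, one_smul]
    conv_lhs => rw [this]
    module
  rw [this, map_add, map_smul, map_smul]
  refine (norm_add_le _ _).trans ?_
  rw [norm_smul, norm_smul, Real.norm_of_nonneg hs, Real.norm_of_nonneg ht]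
  calc _ ≤ s * b + t * b := by gcongr
    _ = b := by rw [← add_mul, hst, one_mul]

lemma expand_orbit {A : Type} {N d d' : ℕ} (hN : 0 < N)
    {f : E d → (ℕ → A) → E N → E N} {p : E d}
    {g : E d' → (ℕ → A) → E N → E N} {p' : E d'} {ℓ : (ℕ → A) → E N → ℝ}
    {η κ ec C C₁ θ ε γ' : ℝ}
    (h0 : 0 ≤ η) (h1 : η ≤ 1) (hκ0 : 0 ≤ κ) (hκ1 : κ < 1) (hec : 0 ≤ ec) (hC : 0 ≤ C)
    (hC₁ : 0 ≤ C₁)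
    (hθ0 : 0 ≤ θ) (hθ1 : θ < 1) (hγ' : 0 < γ') (hε : 0 ≤ ε) (hεγ : ε ≤ γ' / 2)
    (hf : ∀ 𝔟, ∀ x ∈ cube N, f p 𝔟 x ∈ cube N)
    (hg : ∀ 𝔟, ∀ x ∈ cube N, g p' 𝔟 x ∈ cube N)
    (hcon : ∀ 𝔟, ∀ x ∈ cube N, ∀ y ∈ cube N,
      ‖DD N η (f p 𝔟 x - f p 𝔟 y)‖ ≤ κ * ‖DD N η (x - y)‖)
    (hcl : ∀ 𝔟, ∀ x ∈ cube N, ‖DD N η (g p' 𝔟 x - f p 𝔟 x)‖ ≤ ec)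
    (hho : ∀ (𝔟 𝔟₀ : ℕ → A) (q : ℕ), (∀ i < q, 𝔟 i = 𝔟₀ i) → ∀ x ∈ cube N,
      ‖DD N η (f p 𝔟 x - f p 𝔟₀ x)‖ ≤ C * θ ^ q)
    (hMV : MV η ε (g p') ℓ)
    (hℓ : ∀ 𝔟, ∀ x ∈ cube N, γ' ≤ |ℓ 𝔟 x|)
    (hℓ2 : ∀ (𝔟 𝔟₀ : ℕ → A) (q : ℕ), (∀ i < q, 𝔟 i = 𝔟₀ i) → ∀ u ∈ cube N, ∀ z ∈ cube N,
      |ℓ 𝔟 u - ℓ 𝔟₀ z| ≤ ε + C₁ * ‖DD N η (u - z)‖ + C * θ ^ q)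
    (hsm : C₁ * (ec / (1 - κ)) ≤ ε)
    (w : List A) (𝔟 𝔟₀ : ℕ → A) (q : ℕ) (hq : ∀ i < q, 𝔟 i = 𝔟₀ i) {x y z : E N}
    (hx : x ∈ cube N) (hy : y ∈ cube N) (hz : z ∈ cube N) :
    ll ℓ f p w 𝔟₀ z * ‖DD N η (x - y)‖ ≤
      Real.exp ((2 / γ') * (3 * ε * w.length + 2 * C₁ * ((1 - κ ^ w.length) / (1 - κ)) +
        (C₁ * (C / (1 - κ)) + C) * (θ ^ q / (1 - θ)))) *
      ‖DD N η (psi g p' w 𝔟 x - psi g p' w 𝔟 y)‖ := by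
  have hk : 0 < 1 - κ := by linarith
  have ht : 0 < 1 - θ := by linarith
  set C₂ := C₁ * (C / (1 - κ)) + C with hC₂
  have hC₂0 : 0 ≤ C₂ := by positivity
  induction w generalizing 𝔟 𝔟₀ q with
  | nil =>
    simp only [ll, psi, id, one_mul, List.length_nil]
    refine le_mul_of_one_le_left (norm_nonneg _) (Real.one_le_exp ?_)
    simp only [pow_zero, sub_self, zero_div, mul_zero, Nat.cast_zero, zero_add]
    positivity
  | cons a w ih =>
    have hq' := consF_agree hq a
    have i1 := ih _ _ _ hq'
    have dx := dist_orbit h0 h1 hκ0 hκ1 hec hC hθ0 hθ1 hf hg hcon hcl hho w _ _ _ hq' hx hz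
    have dy := dist_orbit h0 h1 hκ0 hκ1 hec hC hθ0 hθ1 hf hg hcon hcl hho w _ _ _ hq' hy hz
    simp only [psi, Function.comp, ll]
    set x1 := psi g p' w (consF a 𝔟) x with hx1
    set y1 := psi g p' w (consF a 𝔟) y with hy1
    set z1 := psi f p w (consF a 𝔟₀) z with hz1
    have hx1c : x1 ∈ cube N := psi_mem hg _ _ hx
    have hy1c : y1 ∈ cube N := psi_mem hg _ _ hy
    have hz1c : z1 ∈ cube N := psi_mem hf _ _ hz
    obtain ⟨u, hu, hu2⟩ := hMV.expand hN h0 (consF a 𝔟) hx1c hy1c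
    have huc : u ∈ cube N := (cube_convex N).segment_subset hx1c hy1c hu
    have du := seg_bound hu dx dy
    have l2 := hℓ2 _ _ _ hq' u huc z1 hz1c
    have l1 := hℓ (consF a 𝔟) u huc
    set n := w.length
    set L := |ℓ (consF a 𝔟) u|
    set L0 := |ℓ (consF a 𝔟₀) z1|
    have l3 : L0 ≤ L + (2 * ε + 2 * C₁ * κ ^ n + C₂ * θ ^ (q+1)) := by
      have b1 : L0 ≤ L + |ℓ (consF a 𝔟) u - ℓ (consF a 𝔟₀) z1| := by
        have := abs_sub_abs_le_abs_sub (ℓ (consF a 𝔟₀) z1) (ℓ (consF a 𝔟) u)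
        rw [abs_sub_comm] at this
        linarith
      have b2 := mul_le_mul_of_nonneg_left du hC₁
      have b3 : C₁ * (2 * κ ^ n + ec / (1 - κ) + C / (1 - κ) * θ ^ (q + 1)) + C * θ ^ (q+1) =
        2 * C₁ * κ ^ n + C₁ * (ec / (1 - κ)) + C₂ * θ ^ (q+1) := by rw [hC₂]; ring
      linarith
    set e := 3 * ε + 2 * C₁ * κ ^ n + C₂ * θ ^ (q+1) with he
    have he0 : 0 ≤ e := by positivity
    have l4 : L0 ≤ (L - ε) * Real.exp ((2 / γ') * e) := by
      have b1 := Real.add_one_le_exp ((2 / γ') * e)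
      have b2 : γ' / 2 ≤ L - ε := by linarith
      have b3 : e ≤ (L - ε) * ((2 / γ') * e) := by
        calc e = γ' / 2 * ((2 / γ') * e) := by field_simp
          _ ≤ _ := by gcongr
      have b4 : (L - ε) * ((2 / γ') * e + 1) ≤ (L - ε) * Real.exp ((2 / γ') * e) := by
        gcongr; linarith
      nlinarith
    have hexp : Real.exp ((2 / γ') * e) * Real.exp ((2 / γ') * (3 * ε * n +
        2 * C₁ * ((1 - κ ^ n) / (1 - κ)) + C₂ * (θ ^ (q+1) / (1 - θ)))) ≤
        Real.exp ((2 / γ') * (3 * ε * (n + 1 : ℕ) +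
        2 * C₁ * ((1 - κ ^ (n+1)) / (1 - κ)) + C₂ * (θ ^ q / (1 - θ)))) := by
      rw [← Real.exp_add, ← mul_add]
      apply Real.exp_le_exp.2
      apply mul_le_mul_of_nonneg_left _ (by positivity)
      have b1 : κ ^ n + (1 - κ ^ n) / (1 - κ) = (1 - κ ^ (n+1)) / (1 - κ) := by
        field_simp; ring
      have b2 : θ ^ (q+1) + θ ^ (q+1) / (1 - θ) ≤ θ ^ q / (1 - θ) := by
        rw [le_div_iff₀ ht, add_mul, div_mul_cancel₀ _ ht.ne', pow_succ]
        have : 0 ≤ θ ^ q := by positivity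
        nlinarith [mul_nonneg this (sq_nonneg (1 - θ))]
      have b3 := mul_le_mul_of_nonneg_left b2 hC₂0
      rw [← b1, he]; push_cast
      linarith
    rw [List.length_cons]
    calc L0 * ll ℓ f p w (consF a 𝔟₀) z * ‖DD N η (x - y)‖
        = L0 * (ll ℓ f p w (consF a 𝔟₀) z * ‖DD N η (x - y)‖) := by ring
      _ ≤ L0 * (Real.exp ((2 / γ') * (3 * ε * n +
        2 * C₁ * ((1 - κ ^ n) / (1 - κ)) + C₂ * (θ ^ (q+1) / (1 - θ)))) * ‖DD N η (x1 - y1)‖) := by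
        gcongr
      _ ≤ ((L - ε) * Real.exp ((2 / γ') * e)) * (Real.exp ((2 / γ') * (3 * ε * n +
        2 * C₁ * ((1 - κ ^ n) / (1 - κ)) + C₂ * (θ ^ (q+1) / (1 - θ)))) * ‖DD N η (x1 - y1)‖) := by
        gcongr
      _ = (Real.exp ((2 / γ') * e) * Real.exp ((2 / γ') * (3 * ε * n +
        2 * C₁ * ((1 - κ ^ n) / (1 - κ)) + C₂ * (θ ^ (q+1) / (1 - θ))))) *
        ((L - ε) * ‖DD N η (x1 - y1)‖) := by ring
      _ ≤ _ := by
        apply mul_le_mul hexp hu2 _ (Real.exp_nonneg _)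
        apply mul_nonneg _ (norm_nonneg _)
        linarith

lemma psi_diff {A : Type} {N d : ℕ} {f : E d → (ℕ → A) → E N → E N} {p : E d}
    (hf : ∀ 𝔟, ∀ x ∈ cube N, f p 𝔟 x ∈ cube N)
    (hd : ∀ 𝔟, ∀ x ∈ cube N, DifferentiableAt ℝ (f p 𝔟) x)
    (w : List A) (𝔟 : ℕ → A) {x : E N} (hx : x ∈ cube N) :
    DifferentiableAt ℝ (psi f p w 𝔟) x := by
  induction w generalizing 𝔟 with
  | nil => exact differentiableAt_id
  | cons a w ih => exact (hd _ _ (psi_mem hf _ _ hx)).comp x (ih _)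

lemma lam_eq_ll {A : Type} {N d : ℕ} (hN : 0 < N) {f : E d → (ℕ → A) → E N → E N} {p : E d}
    (hf : ∀ 𝔟, ∀ x ∈ cube N, f p 𝔟 x ∈ cube N)
    (hd : ∀ 𝔟, ∀ x ∈ cube N, DifferentiableAt ℝ (f p 𝔟) x)
    (hU : ∀ 𝔟, ∀ x ∈ cube N, ∀ i j : Fin N, (i:ℕ) < (j:ℕ) → dentry (f p 𝔟) x i j = 0)
    (w : List A) (𝔟 : ℕ → A) {x : E N} (hx : x ∈ cube N) :
    lam hN f p 𝔟 w x = ll (fun 𝔟 x => dentry (f p 𝔟) x ⟨0, hN⟩ ⟨0, hN⟩) f p w 𝔟 x := by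
  induction w generalizing 𝔟 with
  | nil => simp [lam, ll, psi, dentry]
  | cons a w ih =>
    rw [ll, ← ih]
    have hm := psi_mem hf w (consF a 𝔟) hx
    simp only [lam, dentry, psi]
    rw [fderiv_comp x (hd _ _ hm) (psi_diff hf hd w _ hx), ContinuousLinearMap.comp_apply,
      clm_coord, Finset.sum_eq_single ⟨0, hN⟩, abs_mul, mul_comm]
    · intro j _ hj
      have := hU (consF a 𝔟) _ hm ⟨0, hN⟩ j (by
        rcases Nat.eq_zero_or_pos (j:ℕ) with h | h
        · exact absurd (Fin.ext h) hj
        · exact h)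
      rw [dentry] at this
      rw [this, mul_zero]
    · simp

lemma trunc_succ {A : Type} (α : ℕ → A) (n : ℕ) :
    trunc α (n+1) = α 0 :: trunc (fun i => α (i+1)) n := by
  simp [trunc, List.ofFn_succ]

lemma psi_cauchy {A : Type} {N d : ℕ} {g : E d → (ℕ → A) → E N → E N} {p : E d} {η κ : ℝ}
    (h0 : 0 ≤ η) (h1 : η ≤ 1) (hκ0 : 0 ≤ κ)
    (hg : ∀ 𝔟, ∀ x ∈ cube N, g p 𝔟 x ∈ cube N)
    (hcon : ∀ 𝔟, ∀ x ∈ cube N, ∀ y ∈ cube N,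
      ‖DD N η (g p 𝔟 x - g p 𝔟 y)‖ ≤ κ * ‖DD N η (x - y)‖)
    (n k : ℕ) (hnk : n ≤ k) (α 𝔟 : ℕ → A) {x y : E N} (hx : x ∈ cube N) (hy : y ∈ cube N) :
    ‖DD N η (psi g p (trunc α n) 𝔟 x - psi g p (trunc α k) 𝔟 y)‖ ≤ 2 * κ ^ n := by
  induction n generalizing k α 𝔟 with
  | zero =>
    simpa using DD_cube h0 h1 (psi_mem hg (trunc α 0) 𝔟 hx) (psi_mem hg (trunc α k) 𝔟 hy)
  | succ n ih =>
    obtain ⟨k, rfl⟩ : ∃ j, k = j + 1 := ⟨k - 1, by omega⟩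
    rw [trunc_succ, trunc_succ]
    simp only [psi, Function.comp]
    refine (hcon _ _ (psi_mem hg _ _ hx) _ (psi_mem hg _ _ hy)).trans ?_
    have := mul_le_mul_of_nonneg_left
      (ih k (by omega) (fun i => α (i+1)) (consF (α 0) 𝔟)) hκ0
    rw [pow_succ]; linarith

lemma tendsto_piProj {A : Type} {N d : ℕ} {g : E d → (ℕ → A) → E N → E N} {p : E d} {η κ : ℝ}
    (h0 : 0 < η) (h1 : η ≤ 1) (hκ0 : 0 ≤ κ) (hκ1 : κ < 1)
    (hg : ∀ 𝔟, ∀ x ∈ cube N, g p 𝔟 x ∈ cube N)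
    (hcon : ∀ 𝔟, ∀ x ∈ cube N, ∀ y ∈ cube N,
      ‖DD N η (g p 𝔟 x - g p 𝔟 y)‖ ≤ κ * ‖DD N η (x - y)‖) (𝔟 α : ℕ → A) :
    Tendsto (fun n => psi g p (trunc α n) 𝔟 0) atTop (𝓝 (piProj g p 𝔟 α)) := by
  obtain ⟨c, hc, hcD⟩ := le_DD (N := N) h0
  apply CauchySeq.tendsto_limUnder
  refine cauchySeq_of_le_tendsto_0' (fun n => 2 * κ ^ n / c) (fun n m hnm => ?_) ?_
  · rw [dist_eq_norm, le_div_iff₀ hc, mul_comm]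
    exact (hcD _).trans (psi_cauchy h0.le h1 hκ0 hg hcon n m hnm α 𝔟 (zero_mem_cube N)
      (zero_mem_cube N))
  · have := ((tendsto_pow_atTop_nhds_zero_of_lt_one hκ0 hκ1).const_mul 2).div_const c
    simpa using this

lemma piProj_mem {A : Type} {N d : ℕ} {g : E d → (ℕ → A) → E N → E N} {p : E d} {η κ : ℝ}
    (h0 : 0 < η) (h1 : η ≤ 1) (hκ0 : 0 ≤ κ) (hκ1 : κ < 1)
    (hg : ∀ 𝔟, ∀ x ∈ cube N, g p 𝔟 x ∈ cube N)
    (hcon : ∀ 𝔟, ∀ x ∈ cube N, ∀ y ∈ cube N,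
      ‖DD N η (g p 𝔟 x - g p 𝔟 y)‖ ≤ κ * ‖DD N η (x - y)‖) (𝔟 α : ℕ → A) :
    piProj g p 𝔟 α ∈ cube N :=
  (cube_closed N).mem_of_tendsto (tendsto_piProj h0 h1 hκ0 hκ1 hg hcon 𝔟 α)
    (Eventually.of_forall fun _ => psi_mem hg _ _ (zero_mem_cube N))

lemma piProj_cons {A : Type} {N d : ℕ} {g : E d → (ℕ → A) → E N → E N} {p : E d} {η κ : ℝ}
    (h0 : 0 < η) (h1 : η ≤ 1) (hκ0 : 0 ≤ κ) (hκ1 : κ < 1)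
    (hg : ∀ 𝔟, ∀ x ∈ cube N, g p 𝔟 x ∈ cube N)
    (hd : ∀ 𝔟, ∀ x ∈ cube N, DifferentiableAt ℝ (g p 𝔟) x)
    (hcon : ∀ 𝔟, ∀ x ∈ cube N, ∀ y ∈ cube N,
      ‖DD N η (g p 𝔟 x - g p 𝔟 y)‖ ≤ κ * ‖DD N η (x - y)‖) (𝔟 α : ℕ → A) :
    piProj g p 𝔟 α = g p (consF (α 0) 𝔟) (piProj g p (consF (α 0) 𝔟) (fun i => α (i+1))) := by
  have t1 := (tendsto_piProj h0 h1 hκ0 hκ1 hg hcon 𝔟 α).comp (tendsto_add_atTop_nat 1)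
  have t2 := tendsto_piProj h0 h1 hκ0 hκ1 hg hcon (consF (α 0) 𝔟) (fun i => α (i+1))
  have t3 := ((hd (consF (α 0) 𝔟) _ (piProj_mem h0 h1 hκ0 hκ1 hg hcon (consF (α 0) 𝔟)
    (fun i => α (i+1)))).continuousAt.tendsto).comp t2
  refine tendsto_nhds_unique t1 (t3.congr fun n => ?_)
  simp [Function.comp, trunc_succ, psi]

lemma cyl_cons {A : Type} {a : A} {w : List A} {α : ℕ → A} :
    α ∈ cyl (a :: w) ↔ α 0 = a ∧ (fun i => α (i+1)) ∈ cyl w := by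
  constructor
  · intro h
    refine ⟨h ⟨0, by simp⟩, fun i => ?_⟩
    exact h ⟨i + 1, by simp⟩
  · rintro ⟨h1, h2⟩ ⟨i, hi⟩
    cases i with
    | zero => exact h1
    | succ k => exact h2 ⟨k, by simpa using hi⟩

lemma mem_cyl_trunc {A : Type} {α β : ℕ → A} {n : ℕ} :
    β ∈ cyl (trunc α n) ↔ ∀ i < n, β i = α i := by
  simp only [cyl, trunc, mem_ofPred_eq]
  constructor
  · intro h i hi
    simpa using h ⟨i, by simpa using hi⟩
  · rintro h ⟨i, hi⟩
    simpa using h i (by simpa using hi)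

lemma piProj_cyl {A : Type} {N d : ℕ} {g : E d → (ℕ → A) → E N → E N} {p : E d} {η κ : ℝ}
    (h0 : 0 < η) (h1 : η ≤ 1) (hκ0 : 0 ≤ κ) (hκ1 : κ < 1)
    (hg : ∀ 𝔟, ∀ x ∈ cube N, g p 𝔟 x ∈ cube N)
    (hd : ∀ 𝔟, ∀ x ∈ cube N, DifferentiableAt ℝ (g p 𝔟) x)
    (hcon : ∀ 𝔟, ∀ x ∈ cube N, ∀ y ∈ cube N,
      ‖DD N η (g p 𝔟 x - g p 𝔟 y)‖ ≤ κ * ‖DD N η (x - y)‖) (w : List A) (𝔟 α : ℕ → A)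
    (hα : α ∈ cyl w) :
    piProj g p 𝔟 α = psi g p w 𝔟 (piProj g p (app w 𝔟) (fun i => α (i + w.length))) := by
  induction w generalizing 𝔟 α with
  | nil => simp [psi, app]
  | cons a w ih =>
    rw [cyl_cons] at hα
    obtain ⟨rfl, h⟩ := hα
    rw [piProj_cons h0 h1 hκ0 hκ1 hg hd hcon, ih _ _ h]
    simp [psi, app, add_assoc]

/-- uniform equicontinuity from Hölder dependence on the symbolic variable -/
lemma equicont {A : Type} [Finite A] [Nonempty A] {Z W : Type*} [PseudoMetricSpace Z]
    [SeminormedAddCommGroup W] {K : Set Z} (hK : IsCompact K) (H : (ℕ → A) → Z → W)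
    (hH : ∀ 𝔟, ContinuousOn (H 𝔟) K) {C θ : ℝ} (hθ0 : 0 ≤ θ) (hθ1 : θ < 1)
    (hho : ∀ (𝔟 𝔟₀ : ℕ → A) (q : ℕ), (∀ i < q, 𝔟 i = 𝔟₀ i) → ∀ x ∈ K,
      ‖H 𝔟 x - H 𝔟₀ x‖ ≤ C * θ ^ q) {ε : ℝ} (hε : 0 < ε) :
    ∃ δ > 0, ∀ 𝔟, ∀ x ∈ K, ∀ y ∈ K, dist x y < δ → ‖H 𝔟 x - H 𝔟 y‖ ≤ ε := by
  obtain ⟨a0⟩ := ‹Nonempty A›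
  have ht : Tendsto (fun q : ℕ => C * θ ^ q) atTop (𝓝 0) := by
    simpa using (tendsto_pow_atTop_nhds_zero_of_lt_one hθ0 hθ1).const_mul C
  obtain ⟨q, hq⟩ := (ht.eventually (gt_mem_nhds (show 0 < ε / 3 by positivity))).exists
  let rep : (Fin q → A) → ℕ → A := fun v i => if h : i < q then v ⟨i, h⟩ else a0
  have h1 : ∀ v : Fin q → A, ∃ δ > 0, ∀ x ∈ K, ∀ y ∈ K, dist x y < δ →
      ‖H (rep v) x - H (rep v) y‖ < ε / 3 := by
    intro v
    have := Metric.uniformContinuousOn_iff.1 (hK.uniformContinuousOn_of_continuous (hH (rep v)))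
      (ε/3) (by positivity)
    obtain ⟨δ, hδ, h⟩ := this
    exact ⟨δ, hδ, fun x hx y hy hxy => by simpa [dist_eq_norm] using h x hx y hy hxy⟩
  choose δ hδ hδ2 using h1
  have : Nonempty (Fin q → A) := ⟨fun _ => a0⟩
  obtain ⟨v0, hv0⟩ := Finite.exists_min δ
  refine ⟨δ v0, hδ v0, fun 𝔟 x hx y hy hxy => ?_⟩
  let v : Fin q → A := fun i => 𝔟 i
  have hag : ∀ i < q, 𝔟 i = rep v i := by intro i hi; simp [rep, v, hi]
  have a1 := hho _ _ _ hag x hx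
  have a2 := hho _ _ _ hag y hy
  have a3 := hδ2 v x hx y hy (hxy.trans_le (hv0 v))
  have e : H 𝔟 x - H 𝔟 y = (H 𝔟 x - H (rep v) x) + (H (rep v) x - H (rep v) y) -
    (H 𝔟 y - H (rep v) y) := by abel
  rw [e]
  refine (norm_sub_le _ _).trans ((add_le_add_left (norm_add_le _ _) _).trans ?_)
  linarith

lemma dens_le_seq {N : ℕ} (ν : Measure (E N)) (x : E N) :
    dens ν x ≤ liminf (fun k : ℕ => ν (Metric.ball x (1 / ((k:ℝ) + 1))) /
      volume (Metric.ball (0 : E N) (1 / ((k:ℝ) + 1)))) atTop := by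
  have ht : Tendsto (fun k : ℕ => 1 / ((k:ℝ) + 1)) atTop (𝓝[>] (0:ℝ)) := by
    refine tendsto_nhdsWithin_iff.2 ⟨tendsto_one_div_add_atTop_nhds_zero_nat, ?_⟩
    exact Eventually.of_forall fun k => by simp only [mem_Ioi]; positivity
  have := Filter.liminf_le_liminf_of_le (f := 𝓝[>] (0:ℝ)) ht
    (u := fun rr : ℝ => ν (Metric.ball x rr) / volume (Metric.ball (0 : E N) rr))
  exact this

lemma tonelli_set {P T Ω : Type*} [MeasurableSpace P] [MeasurableSpace T] [MeasurableSpace Ω]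
    (lB : Measure P) [SFinite lB] (lT : Measure T) [SFinite lT]
    (μ : Measure Ω) [SFinite μ] {S : Set (P × (T × (Ω × Ω)))} (hS : MeasurableSet S) :
    ∫⁻ z : P × T × Ω, μ {ω' | (z.1, (z.2.1, (z.2.2, ω'))) ∈ S} ∂(lB.prod (lT.prod μ)) =
      (lB.prod (lT.prod (μ.prod μ))) S := by
  have hS1 : MeasurableSet ((fun z : (P × T × Ω) × Ω => (z.1.1, (z.1.2.1, (z.1.2.2, z.2)))) ⁻¹' S) :=
    hS.preimage (by fun_prop)
  have m1 : Measurable (fun z : P × T × Ω => μ {ω' | (z.1, (z.2.1, (z.2.2, ω'))) ∈ S}) :=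
    measurable_measure_prodMk_left (ν := μ) hS1
  rw [lintegral_prod _ m1.aemeasurable, Measure.prod_apply hS]
  refine lintegral_congr fun p => ?_
  have m2 : Measurable (fun z : T × Ω => μ {ω' | (p, (z.1, (z.2, ω'))) ∈ S}) :=
    m1.comp measurable_prodMk_left
  rw [lintegral_prod _ m2.aemeasurable, Measure.prod_apply (measurable_prodMk_left hS)]
  refine lintegral_congr fun t => ?_
  rw [Measure.prod_apply (measurable_prodMk_left (measurable_prodMk_left hS))]
  rfl

set_option maxHeartbeats 1000000 in
lemma meas_main {P T Ω : Type*} [MeasurableSpace P] [MeasurableSpace T] [MeasurableSpace Ω]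
    (lB : Measure P) [SFinite lB] (lT : Measure T) [IsFiniteMeasure lT]
    (μ : Measure Ω) [IsFiniteMeasure μ] {N : ℕ} (hN : 0 < N) (Φ : P × T × Ω → E N)
    (hΦ : Measurable Φ) (K : ℝ≥0∞) (hK : K ≠ ⊤)
    (hest : ∀ᵐ t ∂lT, ∀ r > (0:ℝ),
      ∫⁻ ω, ∫⁻ ω', lB {p | dist (Φ (p, t, ω')) (Φ (p, t, ω)) < r} ∂μ ∂μ
        ≤ ENNReal.ofReal (r ^ N) * K) :
    ∫⁻ p, ∫⁻ t, ∫⁻ x, dens (Measure.map (fun ω => Φ (p, t, ω)) μ) x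
      ∂(Measure.map (fun ω => Φ (p, t, ω)) μ) ∂lT ∂lB < ⊤ := by
  have : Nonempty (Fin N) := ⟨⟨0, hN⟩⟩
  have hΦ' : ∀ p t, Measurable (fun ω => Φ (p, t, ω)) := fun p t => by fun_prop
  let r : ℕ → ℝ := fun k => 1 / ((k:ℝ) + 1)
  have hr : ∀ k, 0 < r k := fun k => by simp only [r]; positivity
  let V : ℝ≥0∞ := volume (Metric.ball (0 : E N) 1)
  have hV0 : V ≠ 0 := (Metric.measure_ball_pos _ _ one_pos).ne'
  have hVt : V ≠ ⊤ := measure_ball_lt_top.ne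
  have hvol : ∀ k, volume (Metric.ball (0 : E N) (r k)) = ENNReal.ofReal (r k ^ N) * V := by
    intro k
    have := Measure.addHaar_ball (volume : Measure (E N)) 0 (hr k).le
    simpa using this
  let h : ℕ → P × T × Ω → ℝ≥0∞ := fun k z =>
    μ {ω' | dist (Φ (z.1, z.2.1, ω')) (Φ z) < r k} / volume (Metric.ball (0 : E N) (r k))
  have hm : ∀ k, Measurable (h k) := by
    intro k
    have hS : MeasurableSet {z : (P × T × Ω) × Ω |
        dist (Φ (z.1.1, z.1.2.1, z.2)) (Φ z.1) < r k} := by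
      apply measurableSet_lt
      · apply Measurable.dist <;> fun_prop
      · exact measurable_const
    have := measurable_measure_prodMk_left (ν := μ) hS
    exact Measurable.div_const this _
  have s1 : ∀ p t, ∫⁻ x, dens (Measure.map (fun ω => Φ (p, t, ω)) μ) x
      ∂(Measure.map (fun ω => Φ (p, t, ω)) μ) ≤ ∫⁻ ω, liminf (fun k => h k (p, t, ω)) atTop ∂μ := by
    intro p t
    refine (lintegral_map_le _ _).trans (lintegral_mono fun ω => ?_)
    refine (dens_le_seq _ _).trans (le_of_eq ?_)
    congr 1
    ext k
    rw [Measure.map_apply (hΦ' p t) measurableSet_ball]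
    rfl
  have s2 : ∀ k, ∫⁻ z, h k z ∂(lB.prod (lT.prod μ)) ≤ (lT univ * K) / V := by
    intro k
    have hS' : MeasurableSet {z : P × (T × (Ω × Ω)) |
        dist (Φ (z.1, z.2.1, z.2.2.2)) (Φ (z.1, z.2.1, z.2.2.1)) < r k} := by
      apply measurableSet_lt
      · apply Measurable.dist <;> fun_prop
      · exact measurable_const
    have hk0 : ENNReal.ofReal (r k ^ N) ≠ 0 := by
      simp only [ne_eq, ENNReal.ofReal_eq_zero, not_le]; have := hr k; positivity
    have hkt : ENNReal.ofReal (r k ^ N) ≠ ⊤ := ENNReal.ofReal_ne_top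
    have hc0 : (volume (Metric.ball (0 : E N) (r k)))⁻¹ ≠ ⊤ := by
      rw [hvol]; simp [hV0, hk0]
    simp only [h, div_eq_mul_inv]
    rw [lintegral_mul_const' _ _ hc0]
    have e1 : ∫⁻ z, μ {ω' | dist (Φ (z.1, z.2.1, ω')) (Φ z) < r k} ∂(lB.prod (lT.prod μ)) =
        (lB.prod (lT.prod (μ.prod μ))) {z : P × (T × (Ω × Ω)) |
        dist (Φ (z.1, z.2.1, z.2.2.2)) (Φ (z.1, z.2.1, z.2.2.1)) < r k} := by
      exact tonelli_set lB lT μ hS'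
    rw [e1, Measure.prod_apply_symm hS']
    have m3 := measurable_measure_prodMk_right (μ := lB) hS'
    rw [lintegral_prod _ m3.aemeasurable]
    have e2 : ∀ᵐ t ∂lT, ∫⁻ y, lB ((fun x => (x, (t, y))) ⁻¹' {z : P × (T × (Ω × Ω)) |
        dist (Φ (z.1, z.2.1, z.2.2.2)) (Φ (z.1, z.2.1, z.2.2.1)) < r k}) ∂(μ.prod μ) ≤
        ENNReal.ofReal (r k ^ N) * K := by
      filter_upwards [hest] with t ht
      have m4 : Measurable (fun y : Ω × Ω => lB ((fun x => (x, (t, y))) ⁻¹'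
        {z : P × (T × (Ω × Ω)) |
        dist (Φ (z.1, z.2.1, z.2.2.2)) (Φ (z.1, z.2.1, z.2.2.1)) < r k})) :=
        m3.comp (g := fun q => lB ((fun x => (x, q)) ⁻¹' {z : P × (T × (Ω × Ω)) |
        dist (Φ (z.1, z.2.1, z.2.2.2)) (Φ (z.1, z.2.1, z.2.2.1)) < r k}))
        (f := fun y : Ω × Ω => (t, y)) (by fun_prop)
      rw [lintegral_prod _ m4.aemeasurable]
      exact ht (r k) (hr k)
    calc _ ≤ (∫⁻ t, ENNReal.ofReal (r k ^ N) * K ∂lT) *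
          (volume (Metric.ball (0 : E N) (r k)))⁻¹ := by
          gcongr ?_ * _
          exact lintegral_mono_ae e2
      _ = _ := by
        rw [lintegral_const, hvol, ENNReal.mul_inv (Or.inl hk0) (Or.inl hkt)]
        calc _ = (ENNReal.ofReal (r k ^ N) * (ENNReal.ofReal (r k ^ N))⁻¹) * (lT univ * K * V⁻¹) := by
              ring
          _ = _ := by rw [ENNReal.mul_inv_cancel hk0 hkt, one_mul]
  have ml : Measurable (fun z => liminf (fun k => h k z) atTop) := Measurable.liminf hm
  calc _ ≤ ∫⁻ p, ∫⁻ t, ∫⁻ ω, liminf (fun k => h k (p, t, ω)) atTop ∂μ ∂lT ∂lB :=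
        lintegral_mono fun p => lintegral_mono fun t => s1 p t
    _ = ∫⁻ z, liminf (fun k => h k z) atTop ∂(lB.prod (lT.prod μ)) := by
        rw [lintegral_prod _ ml.aemeasurable]
        congr 1; ext p
        have m5 : Measurable (fun y : T × Ω => liminf (fun k => h k (p, y)) atTop) :=
          ml.comp measurable_prodMk_left
        rw [lintegral_prod _ m5.aemeasurable]
    _ ≤ liminf (fun k => ∫⁻ z, h k z ∂(lB.prod (lT.prod μ))) atTop := lintegral_liminf_le hm
    _ ≤ (lT univ * K) / V := by
        refine liminf_le_of_frequently_le' ?_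
        exact Frequently.of_forall s2
    _ < ⊤ := ENNReal.div_lt_top (ENNReal.mul_ne_top (measure_ne_top _ _) hK) hV0

lemma exists_R {A : Type} [Finite A] [Nonempty A] [MeasurableSpace A] :
    ∃ R : (ℕ → A) → (ℕ → A), (∀ w : List A, MeasurableSet (R ⁻¹' cyl w)) ∧
      ∀ s : Set (ℕ → A), MeasurableSet s → R ⁻¹' s = s := by
  let rep : A → A := fun a => Function.invFun (measurableAtom (β := A)) (measurableAtom a)
  have hrep : ∀ a, measurableAtom (rep a) = measurableAtom a := fun a =>
    Function.invFun_eq ⟨a, rfl⟩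
  have hinv : ∀ V : Set A, MeasurableSet V → ∀ a, rep a ∈ V ↔ a ∈ V := by
    intro V hV a
    constructor
    · intro h
      refine mem_of_mem_measurableAtom ?_ hV h
      rw [hrep]; exact mem_measurableAtom_self a
    · intro h
      refine mem_of_mem_measurableAtom ?_ hV h
      rw [← hrep]; exact mem_measurableAtom_self _
  have hmeas : ∀ U : Set A, MeasurableSet (rep ⁻¹' U) := by
    intro U
    have : rep ⁻¹' U = ⋃ a ∈ {a | rep a ∈ U}, measurableAtom a := by
      ext b
      simp only [mem_preimage, mem_iUnion, mem_ofPred_eq, exists_prop]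
      constructor
      · exact fun h => ⟨b, h, mem_measurableAtom_self b⟩
      · rintro ⟨a, ha, hb⟩
        have : measurableAtom b = measurableAtom a := measurableAtom_eq_of_mem hb
        have h2 : rep b = rep a := by simp only [rep, this]
        rw [h2]; exact ha
    rw [this]
    exact MeasurableSet.biUnion (Set.to_countable _)
      fun a _ => MeasurableSet.measurableAtom_of_countable a
  refine ⟨fun α i => rep (α i), fun w => ?_, fun s hs => ?_⟩
  · have : (fun (α : ℕ → A) i => rep (α i)) ⁻¹' cyl w =
        ⋂ i : Fin w.length, (fun α : ℕ → A => α i) ⁻¹' (rep ⁻¹' {w.get i}) := by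
      ext α; simp [cyl]
    rw [this]
    exact MeasurableSet.iInter fun i => measurable_pi_apply _ (hmeas _)
  · have key : ∀ s, MeasurableSet[MeasurableSpace.generateFrom
        {s : Set (ℕ → A) | ∃ i, ∃ t, MeasurableSet t ∧ (fun α : ℕ → A => α i) ⁻¹' t = s}] s →
        (fun (α : ℕ → A) i => rep (α i)) ⁻¹' s = s := by
      intro s hs
      induction s, hs using MeasurableSpace.generateFrom_induction with
      | hC t ht _ =>
        obtain ⟨i, V, hV, rfl⟩ := ht
        ext α
        exact hinv V hV (α i)
      | empty => simp
      | compl t _ ih => rw [preimage_compl, ih]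
      | iUnion f _ ih => rw [preimage_iUnion]; exact iUnion_congr ih
    apply key
    have e : (MeasurableSpace.pi : MeasurableSpace (ℕ → A)) = MeasurableSpace.generateFrom
        {s : Set (ℕ → A) | ∃ i, ∃ t, MeasurableSet t ∧ (fun α : ℕ → A => α i) ⁻¹' t = s} := by
      rw [MeasurableSpace.pi]
      simp_rw [MeasurableSpace.comap_eq_generateFrom]
      rw [MeasurableSpace.iSup_generateFrom]
      congr 1
      ext s; simp
    rw [← e]; exact hs

lemma map_R {X : Type*} [MeasurableSpace X] {Y : Type*} [MeasurableSpace Y]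
    [MeasurableSingletonClass Y] {R : X → X}
    (hR : ∀ s : Set X, MeasurableSet s → R ⁻¹' s = s) (μ : Measure X) (φ : X → Y)
    (hφ : AEMeasurable φ μ) :
    Measure.map φ μ = Measure.map (fun x => φ (R x)) μ := by
  apply Measure.map_congr
  obtain ⟨ψ, hψ, he⟩ := hφ
  have hψR : ∀ x, ψ (R x) = ψ x := by
    intro x
    have := hR (ψ ⁻¹' {ψ x}) (hψ (measurableSet_singleton _))
    have hx : x ∈ R ⁻¹' (ψ ⁻¹' {ψ x}) := by rw [this]; simp
    exact hx
  obtain ⟨Z, hZ, hZm, hZ0⟩ := exists_measurable_superset_of_null (s := {x | ¬ φ x = ψ x}) he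
  rw [EventuallyEq, ae_iff]
  refine measure_mono_null ?_ hZ0
  intro x hx
  by_contra hxZ
  have h1 : φ x = ψ x := by
    by_contra h; exact hxZ (hZ h)
  have h2 : R x ∉ Z := by
    intro h
    have : x ∈ R ⁻¹' Z := h
    rw [hR Z hZm] at this; exact hxZ this
  have h3 : φ (R x) = ψ (R x) := by
    by_contra h; exact h2 (hZ h)
  exact hx (by rw [h1, h3, hψR])

lemma integral_le_R {X : Type*} [MeasurableSpace X] {N : ℕ} {R : X → X}
    (hR : ∀ s : Set X, MeasurableSet s → R ⁻¹' s = s) (μ : Measure X) (φ : X → E N) :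
    ∫⁻ x, dens (Measure.map φ μ) x ∂(Measure.map φ μ) ≤
      ∫⁻ x, dens (Measure.map (fun x => φ (R x)) μ) x ∂(Measure.map (fun x => φ (R x)) μ) := by
  by_cases h : AEMeasurable φ μ
  · rw [map_R hR μ φ h]
  · rw [Measure.map_of_not_aemeasurable h]; simp

lemma measure_R_cyl {X : Type*} [MeasurableSpace X] {R : X → X}
    (hR : ∀ s : Set X, MeasurableSet s → R ⁻¹' s = s) (μ : Measure X) (s : Set X) :
    μ (R ⁻¹' s) ≤ μ s := by
  rw [← measure_toMeasurable s]
  rw [← hR _ (measurableSet_toMeasurable μ s)]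
  exact measure_mono (preimage_mono (subset_toMeasurable μ s))

lemma slice_fderiv {N d : ℕ} {h : E d → E N → E N} {p : E d} {x : E N}
    (hd : DifferentiableAt ℝ (fun q : E d × E N => h q.1 q.2) (p, x)) :
    HasFDerivAt (h p) ((fderiv ℝ (fun q : E d × E N => h q.1 q.2) (p, x)).comp
      (ContinuousLinearMap.inr ℝ (E d) (E N))) x :=
  HasFDerivAt.comp (f := fun x => (p, x)) x hd.hasFDerivAt (hasFDerivAt_prodMk_right p x)

lemma smooth_diff {N d : ℕ} {r : ℕ∞} (hr : 2 ≤ r) {h : E d → E N → E N} {P' : Set (E d)}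
    {X' : Set (E N)} (hP : IsOpen P') (hX : IsOpen X')
    (hs : ContDiffOn ℝ r (fun q : E d × E N => h q.1 q.2) (P' ×ˢ X')) {p : E d} {x : E N}
    (hp : p ∈ P') (hx : x ∈ X') :
    DifferentiableAt ℝ (fun q : E d × E N => h q.1 q.2) (p, x) := by
  have h1 : (r : WithTop ℕ∞) ≠ 0 := by
    intro h
    have : r = 0 := by exact_mod_cast h
    rw [this] at hr; simp at hr
  exact (hs.differentiableOn h1).differentiableAt ((hP.prod hX).mem_nhds ⟨hp, hx⟩)

lemma smooth_fderiv_cont {N d : ℕ} {r : ℕ∞} (hr : 2 ≤ r) {h : E d → E N → E N} {P' : Set (E d)}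
    {X' : Set (E N)} (hP : IsOpen P') (hX : IsOpen X')
    (hs : ContDiffOn ℝ r (fun q : E d × E N => h q.1 q.2) (P' ×ˢ X')) :
    ContinuousOn (fun q : E d × E N => fderiv ℝ (h q.1) q.2) (P' ×ˢ X') := by
  have h1 : (1 : WithTop ℕ∞) ≤ r := by
    have : (1 : ℕ∞) ≤ r := le_trans (by norm_num) hr
    exact_mod_cast this
  have c1 := hs.continuousOn_fderiv_of_isOpen (hP.prod hX) h1
  have c2 : ContinuousOn (fun q : E d × E N =>
      (fderiv ℝ (fun q : E d × E N => h q.1 q.2) q).comp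
      (ContinuousLinearMap.inr ℝ (E d) (E N))) (P' ×ˢ X') := c1.clm_comp continuousOn_const
  refine c2.congr fun q hq => ?_
  exact (slice_fderiv (smooth_diff hr hP hX hs hq.1 hq.2)).fderiv

lemma exists_cons {A : Type} (𝔟 : ℕ → A) : consF (𝔟 0) (fun i => 𝔟 (i+1)) = 𝔟 := by
  funext n; cases n <;> rfl

lemma ell_bounds {A : Type} {N d : ℕ} (hN : 0 < N) {f : E d → (ℕ → A) → E N → E N} {γ' γ : ℝ}
    (hγ : GammaBounds hN f γ' γ) {p : E d} (hp : p ∈ closure (cubeO d)) (𝔟 : ℕ → A) {x : E N}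
    (hx : x ∈ cube N) :
    γ' < |dentry (f p 𝔟) x ⟨0, hN⟩ ⟨0, hN⟩| ∧ |dentry (f p 𝔟) x ⟨0, hN⟩ ⟨0, hN⟩| < γ := by
  have := hγ.2.2.2 p hp (fun i => 𝔟 (i+1)) (𝔟 0) x hx
  simpa [lam, psi, exists_cons] using this

lemma dentry_sub_le {N : ℕ} (g h : E N → E N) (x y : E N) (i j : Fin N) :
    |dentry g x i j - dentry h y i j| ≤ ‖fderiv ℝ g x - fderiv ℝ h y‖ := by
  have a1 := coord_le_norm ((fderiv ℝ g x - fderiv ℝ h y) (EuclideanSpace.single j (1:ℝ))) i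
  have a2 := (fderiv ℝ g x - fderiv ℝ h y).le_opNorm (EuclideanSpace.single j (1:ℝ))
  simp only [PiLp.norm_single, norm_one, mul_one] at a2
  exact a1.trans a2

/-- The properties of a perturbation that are used. -/
def Close {A : Type} {N d : ℕ} (f g : E d → (ℕ → A) → E N → E N) (B : Set (E d)) (θ : ℝ) : Prop :=
  ∀ p ∈ B, ∀ 𝔟 : ℕ → A, ∀ x ∈ cube N, g p 𝔟 x ∈ cube N ∧ DifferentiableAt ℝ (g p 𝔟) x ∧
    ‖f p 𝔟 x - g p 𝔟 x‖ ≤ θ ∧ ‖fderiv ℝ (f p 𝔟) x - fderiv ℝ (g p 𝔟) x‖ ≤ θ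

lemma system_const {A : Type} [Finite A] [Nonempty A] {N d : ℕ} {r : ℕ∞}
    (hN : 0 < N) (hr : 2 ≤ r)
    (S : SkewFamily A N d r)
    (hU : UnipOn hN S.f S.P' S.X')
    (γ' γ : ℝ) (hγ : GammaBounds hN S.f γ' γ)
    (p₀ : E d) (hp₀ : p₀ ∈ cubeO d) (𝔞 𝔞₀ : ℕ → A) (ε' : ℝ) (hε' : 0 < ε') :
    (∀ w : List A, 0 < Lam hN S.f p₀ 𝔞₀ w ∧ Lam hN S.f p₀ 𝔞₀ w ≤ γ ^ w.length) ∧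
    ∃ δ > (0:ℝ), Metric.ball p₀ δ ⊆ cubeO d ∧ ∃ θ₀ > (0:ℝ), ∃ η κ K : ℝ, 0 < η ∧ η ≤ 1 ∧
      0 ≤ κ ∧ κ < 1 ∧ 0 < K ∧ ∀ g : E d → (ℕ → A) → E N → E N,
      Close S.f g (Metric.ball p₀ δ) θ₀ → ∀ p ∈ Metric.ball p₀ δ,
      (∀ 𝔟, ∀ x ∈ cube N, ∀ y ∈ cube N,
        ‖DD N η (g p 𝔟 x - g p 𝔟 y)‖ ≤ κ * ‖DD N η (x - y)‖) ∧
      ∀ w : List A, ∀ x ∈ cube N, ∀ y ∈ cube N,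
        Lam hN S.f p₀ 𝔞₀ w * ‖x - y‖ ≤
          K * Real.exp (ε' * w.length) * ‖psi g p w 𝔞 x - psi g p w 𝔞 y‖ := by
  obtain ⟨hγ'0, hγ'γ, hγ1, -⟩ := id hγ
  have hγ0 : 0 < γ := hγ'0.trans hγ'γ
  have hcl₀ : p₀ ∈ closure (cubeO d) := subset_closure hp₀
  have hp₀P : p₀ ∈ S.P' := S.P_subset hcl₀
  set f := S.f with hfdef
  let ℓ : (ℕ → A) → E N → ℝ := fun 𝔟 x => dentry (f p₀ 𝔟) x ⟨0, hN⟩ ⟨0, hN⟩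
  have hℓ : ∀ 𝔟, ∀ x ∈ cube N, γ' ≤ |ℓ 𝔟 x| ∧ |ℓ 𝔟 x| ≤ γ := fun 𝔟 x hx =>
    ⟨(ell_bounds hN hγ hcl₀ 𝔟 hx).1.le, (ell_bounds hN hγ hcl₀ 𝔟 hx).2.le⟩
  have hf : ∀ 𝔟, ∀ x ∈ cube N, f p₀ 𝔟 x ∈ cube N := fun 𝔟 x hx =>
    S.into 𝔟 p₀ hp₀P ⟨x, S.X_subset hx, rfl⟩
  have hd : ∀ 𝔟, ∀ x ∈ cube N, DifferentiableAt ℝ (f p₀ 𝔟) x := fun 𝔟 x hx =>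
    (slice_fderiv (h := fun p x => f p 𝔟 x) (smooth_diff (h := fun p x => f p 𝔟 x) hr S.P'_open S.X'_open (S.smooth 𝔟) hp₀P
      (S.X_subset hx))).differentiableAt
  have hUU : ∀ 𝔟, ∀ x ∈ cube N, ∀ i j : Fin N, (i:ℕ) < (j:ℕ) → dentry (f p₀ 𝔟) x i j = 0 :=
    fun 𝔟 x hx => (hU p₀ hp₀P 𝔟 x (S.X_subset hx)).1
  have hUD : ∀ 𝔟, ∀ x ∈ cube N, ∀ i, dentry (f p₀ 𝔟) x i i = ℓ 𝔟 x :=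
    fun 𝔟 x hx i => (hU p₀ hp₀P 𝔟 x (S.X_subset hx)).2.1 i ⟨0, hN⟩
  have hlam : ∀ w : List A, ∀ z ∈ cube N, lam hN f p₀ 𝔞₀ w z = ll ℓ f p₀ w 𝔞₀ z :=
    fun w z hz => lam_eq_ll hN hf hd hUU w 𝔞₀ hz
  have hne : (cube N).Nonempty := ⟨0, zero_mem_cube N⟩
  refine ⟨fun w => ?_, ?_⟩
  · have hb : ∀ y ∈ (fun x => lam hN f p₀ 𝔞₀ w x) '' cube N, y ≤ γ ^ w.length := by
      rintro _ ⟨x, hx, rfl⟩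
      simp only
      rw [hlam w x hx]
      exact (ll_bounds hγ'0 hf hℓ w 𝔞₀ hx).2
    constructor
    · refine lt_of_lt_of_le ?_ (le_csSup ⟨_, hb⟩ ⟨0, zero_mem_cube N, rfl⟩)
      simp only
      rw [hlam w 0 (zero_mem_cube N)]
      exact lt_of_lt_of_le (by positivity) (ll_bounds hγ'0 hf hℓ w 𝔞₀ (zero_mem_cube N)).1
    · exact csSup_le (hne.image _) hb
  -- Hölder constants
  obtain ⟨Ca, hCa, θa, ⟨hθa0, hθa1⟩, hHa⟩ := S.holder0
  obtain ⟨Cb, hCb, θb, ⟨hθb0, hθb1⟩, hHb⟩ := S.holder1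
  let C := max Ca Cb
  let θ := max θa θb
  have hC0 : 0 ≤ C := hCa.le.trans (le_max_left _ _)
  have hθ0 : 0 ≤ θ := hθa0.le.trans (le_max_left _ _)
  have hθ1 : θ < 1 := max_lt hθa1 hθb1
  have hH0 : ∀ p ∈ S.P', ∀ (𝔟 𝔟₀ : ℕ → A) (q : ℕ), (∀ i < q, 𝔟 i = 𝔟₀ i) → ∀ x ∈ cube N,
      ‖f p 𝔟 x - f p 𝔟₀ x‖ ≤ C * θ ^ q := fun p hp 𝔟 𝔟₀ q hq x hx => by
    refine (hHa p hp 𝔟 𝔟₀ q hq x (S.X_subset hx)).trans ?_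
    gcongr
    · exact le_max_left _ _
    · exact le_max_left _ _
  have hH1 : ∀ p ∈ S.P', ∀ (𝔟 𝔟₀ : ℕ → A) (q : ℕ), (∀ i < q, 𝔟 i = 𝔟₀ i) → ∀ x ∈ cube N,
      ‖fderiv ℝ (f p 𝔟) x - fderiv ℝ (f p 𝔟₀) x‖ ≤ C * θ ^ q := fun p hp 𝔟 𝔟₀ q hq x hx => by
    refine (hHb p hp 𝔟 𝔟₀ q hq x (S.X_subset hx)).trans ?_
    gcongr
    · exact le_max_right _ _
    · exact le_max_right _ _
  -- compact set
  have hcomp : IsCompact (closure (cubeO d) ×ˢ cube N) := by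
    refine IsCompact.prod ?_ (cube_compact N)
    exact (cube_compact d).of_isClosed_subset isClosed_closure
      (closure_minimal (cubeO_sub d) (cube_closed d))
  have hsub : closure (cubeO d) ×ˢ cube N ⊆ S.P' ×ˢ S.X' := prod_mono S.P_subset S.X_subset
  have hc0 : ∀ 𝔟, ContinuousOn (fun q : E d × E N => f q.1 𝔟 q.2) (closure (cubeO d) ×ˢ cube N) :=
    fun 𝔟 => ((S.smooth 𝔟).continuousOn).mono hsub
  have hc1 : ∀ 𝔟, ContinuousOn (fun q : E d × E N => fderiv ℝ (f q.1 𝔟) q.2)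
      (closure (cubeO d) ×ˢ cube N) :=
    fun 𝔟 => (smooth_fderiv_cont (h := fun p x => f p 𝔟 x) hr S.P'_open S.X'_open
      (S.smooth 𝔟)).mono hsub
  -- bound on derivative
  obtain ⟨M, hM0, hM⟩ : ∃ M : ℝ, 0 ≤ M ∧ ∀ 𝔟, ∀ x ∈ cube N, ‖fderiv ℝ (f p₀ 𝔟) x‖ ≤ M := by
    obtain ⟨M0, hM0⟩ := hcomp.exists_bound_of_continuousOn (hc1 𝔞)
    have hb : ∀ 𝔟, ∀ x ∈ cube N, ‖fderiv ℝ (f p₀ 𝔟) x‖ ≤ M0 + C := by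
      intro 𝔟 x hx
      have a1 := hM0 (p₀, x) ⟨hcl₀, hx⟩
      have a2 := hH1 p₀ hp₀P 𝔟 𝔞 0 (by simp) x hx
      have a3 := norm_le_norm_add_norm_sub' (fderiv ℝ (f p₀ 𝔟) x) (fderiv ℝ (f p₀ 𝔞) x)
      simp only [pow_zero, mul_one] at a1 a2
      linarith
    exact ⟨M0 + C, (norm_nonneg _).trans (hb 𝔞 0 (zero_mem_cube N)), hb⟩
  -- choice of constants
  obtain ⟨ε, hε, hε1, hε2, hε3⟩ : ∃ ε > 0, ε ≤ γ' / 2 ∧ ε ≤ (1 - γ) / 2 ∧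
      (2 / γ') * (3 * ε) ≤ ε' := by
    refine ⟨min (γ' / 2) (min ((1 - γ) / 2) (ε' * γ' / 6)), ?_, min_le_left _ _,
      (min_le_right _ _).trans (min_le_left _ _), ?_⟩
    · have : 0 < 1 - γ := by linarith
      positivity
    · calc _ ≤ (2 / γ') * (3 * (ε' * γ' / 6)) := by
            gcongr; exact (min_le_right _ _).trans (min_le_right _ _)
        _ = ε' := by field_simp; norm_num
  obtain ⟨η, hη0, hη1, hη⟩ : ∃ η : ℝ, 0 < η ∧ η ≤ 1 ∧ N * M * η ≤ ε / 2 := by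
    have hpos : 0 < 2 * (N * M + 1) := by positivity
    refine ⟨min 1 (ε / (2 * (N * M + 1))), by positivity, min_le_left _ _, ?_⟩
    calc N * M * min 1 (ε / (2 * (N * M + 1))) ≤ (N * M + 1) * (ε / (2 * (N * M + 1))) := by
          gcongr
          · linarith
          · exact min_le_right _ _
      _ = ε / 2 := by field_simp
  obtain ⟨c, hc, hcD⟩ := le_DD (N := N) hη0
  obtain ⟨δ₁, hδ₁, hδ₁2⟩ := equicont hcomp (fun 𝔟 (q : E d × E N) => fderiv ℝ (f q.1 𝔟) q.2) hc1
    hθ0 hθ1 (fun 𝔟 𝔟₀ q hq x hx => hH1 x.1 (S.P_subset hx.1) 𝔟 𝔟₀ q hq x.2 hx.2) hε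
  set C₁ := 2 * M / (δ₁ * c) with hC₁
  have hC₁0 : 0 ≤ C₁ := by positivity
  set κ := γ + ε with hκ
  have hκ0 : 0 ≤ κ := by positivity
  have hκ1 : κ < 1 := by linarith
  have hk : 0 < 1 - κ := by linarith
  obtain ⟨ec, hec, hec1, hec2⟩ : ∃ ec : ℝ, 0 < ec ∧ C₁ * (ec / (1 - κ)) ≤ ε ∧ ec / c ≤ ε / 2 := by
    refine ⟨min (ε * (1 - κ) / (C₁ + 1)) (ε * c / 2), by positivity, ?_, ?_⟩
    · calc _ ≤ (C₁ + 1) * ((ε * (1 - κ) / (C₁ + 1)) / (1 - κ)) := by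
            gcongr
            · linarith
            · exact min_le_left _ _
        _ = ε := by field_simp
    · calc _ ≤ (ε * c / 2) / c := by gcongr; exact min_le_right _ _
        _ = ε / 2 := by field_simp
  obtain ⟨δ₂, hδ₂, hδ₂2⟩ := equicont hcomp (fun 𝔟 (q : E d × E N) => fderiv ℝ (f q.1 𝔟) q.2) hc1
    hθ0 hθ1 (fun 𝔟 𝔟₀ q hq x hx => hH1 x.1 (S.P_subset hx.1) 𝔟 𝔟₀ q hq x.2 hx.2) (half_pos hec)
  obtain ⟨δ₃, hδ₃, hδ₃2⟩ := equicont hcomp (fun 𝔟 (q : E d × E N) => f q.1 𝔟 q.2) hc0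
    hθ0 hθ1 (fun 𝔟 𝔟₀ q hq x hx => hH0 x.1 (S.P_subset hx.1) 𝔟 𝔟₀ q hq x.2 hx.2) (half_pos hec)
  obtain ⟨δ₄, hδ₄, hδ₄2⟩ := Metric.isOpen_iff.1 (cubeO_open d) p₀ hp₀
  have hMVf : MV η ε (f p₀) ℓ := by
    refine MV_of (F := f p₀) (M := M) (e := ec) hη0 hη1 hc hcD _ ℓ hd hM hUU hUD ?_ (by linarith)
    intro 𝔟 x hx; simpa using hec.le
  have hcon : ∀ 𝔟, ∀ x ∈ cube N, ∀ y ∈ cube N,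
      ‖DD N η (f p₀ 𝔟 x - f p₀ 𝔟 y)‖ ≤ κ * ‖DD N η (x - y)‖ := fun 𝔟 x hx y hy =>
    hMVf.contr hη0.le hε.le hγ0.le (fun 𝔟 x hx => (hℓ 𝔟 x hx).2) 𝔟 hx hy
  have hho : ∀ (𝔟 𝔟₀ : ℕ → A) (q : ℕ), (∀ i < q, 𝔟 i = 𝔟₀ i) → ∀ x ∈ cube N,
      ‖DD N η (f p₀ 𝔟 x - f p₀ 𝔟₀ x)‖ ≤ C * θ ^ q := fun 𝔟 𝔟₀ q hq x hx =>
    (DD_le hη0.le hη1 _).trans (hH0 p₀ hp₀P 𝔟 𝔟₀ q hq x hx)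
  have hℓ2 : ∀ (𝔟 𝔟₀ : ℕ → A) (q : ℕ), (∀ i < q, 𝔟 i = 𝔟₀ i) → ∀ u ∈ cube N, ∀ z ∈ cube N,
      |ℓ 𝔟 u - ℓ 𝔟₀ z| ≤ ε + C₁ * ‖DD N η (u - z)‖ + C * θ ^ q := by
    intro 𝔟 𝔟₀ q hq u hu z hz
    have a1 := dentry_sub_le (f p₀ 𝔟) (f p₀ 𝔟) u z ⟨0, hN⟩ ⟨0, hN⟩
    have a2 := dentry_sub_le (f p₀ 𝔟) (f p₀ 𝔟₀) z z ⟨0, hN⟩ ⟨0, hN⟩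
    have a3 := hH1 p₀ hp₀P 𝔟 𝔟₀ q hq z hz
    have a4 : ‖fderiv ℝ (f p₀ 𝔟) u - fderiv ℝ (f p₀ 𝔟) z‖ ≤ ε + C₁ * ‖DD N η (u - z)‖ := by
      rcases lt_or_ge (dist u z) δ₁ with h | h
      · have := hδ₁2 𝔟 (p₀, u) ⟨hcl₀, hu⟩ (p₀, z) ⟨hcl₀, hz⟩ (by simpa [Prod.dist_eq, hδ₁] using h)
        have h2 : 0 ≤ C₁ * ‖DD N η (u - z)‖ := by positivity
        simp only at this
        linarith
      · have b1 := norm_sub_le (fderiv ℝ (f p₀ 𝔟) u) (fderiv ℝ (f p₀ 𝔟) z)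
        have b2 := hM 𝔟 u hu
        have b3 := hM 𝔟 z hz
        have b4 : 2 * M ≤ C₁ * ‖DD N η (u - z)‖ := by
          calc 2 * M = C₁ * (c * δ₁) := by rw [hC₁]; field_simp
            _ ≤ C₁ * (c * ‖u - z‖) := by rw [← dist_eq_norm]; gcongr
            _ ≤ _ := by gcongr; exact hcD _
        linarith
    have a5 := abs_sub_le (ℓ 𝔟 u) (ℓ 𝔟 z) (ℓ 𝔟₀ z)
    simp only [ℓ] at a5 ⊢
    linarith
  set K₂ := (2 / γ') * (2 * C₁ * (1 / (1 - κ)) + (C₁ * (C / (1 - κ)) + C) * (1 / (1 - θ))) with hK₂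
  refine ⟨min δ₂ (min δ₃ δ₄), by positivity, fun p hp => hδ₄2 ?_, ec / 2, half_pos hec, η, κ,
    Real.exp K₂ / c, hη0, hη1, hκ0, hκ1, by positivity, fun g hg p hp => ?_⟩
  · exact Metric.ball_subset_ball ((min_le_right _ _).trans (min_le_right _ _)) hp
  have hpO : p ∈ cubeO d :=
    hδ₄2 (Metric.ball_subset_ball ((min_le_right _ _).trans (min_le_right _ _)) hp)
  have hpcl : p ∈ closure (cubeO d) := subset_closure hpO
  have hpd : dist p p₀ < min δ₂ (min δ₃ δ₄) := hp
  have hpd2 : dist p p₀ < δ₂ := hpd.trans_le (min_le_left _ _)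
  have hpd3 : dist p p₀ < δ₃ := hpd.trans_le ((min_le_right _ _).trans (min_le_left _ _))
  have hclD : ∀ 𝔟, ∀ x ∈ cube N, ‖fderiv ℝ (f p₀ 𝔟) x - fderiv ℝ (g p 𝔟) x‖ ≤ ec := by
    intro 𝔟 x hx
    have a1 := hδ₂2 𝔟 (p, x) ⟨hpcl, hx⟩ (p₀, x) ⟨hcl₀, hx⟩ (by simpa [Prod.dist_eq, hδ₂] using hpd2)
    have a2 := (hg p hp 𝔟 x hx).2.2.2
    have a3 := norm_sub_le_norm_sub_add_norm_sub (fderiv ℝ (f p₀ 𝔟) x) (fderiv ℝ (f p 𝔟) x)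
      (fderiv ℝ (g p 𝔟) x)
    rw [norm_sub_rev] at a1
    simp only at a1
    linarith
  have hcl0 : ∀ 𝔟, ∀ x ∈ cube N, ‖DD N η (g p 𝔟 x - f p₀ 𝔟 x)‖ ≤ ec := by
    intro 𝔟 x hx
    refine (DD_le hη0.le hη1 _).trans ?_
    have a1 := hδ₃2 𝔟 (p, x) ⟨hpcl, hx⟩ (p₀, x) ⟨hcl₀, hx⟩ (by simpa [Prod.dist_eq, hδ₃] using hpd3)
    have a2 := (hg p hp 𝔟 x hx).2.2.1
    have a3 := norm_sub_le_norm_sub_add_norm_sub (g p 𝔟 x) (f p 𝔟 x) (f p₀ 𝔟 x)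
    rw [norm_sub_rev] at a2
    simp only at a1
    linarith
  have hgc : ∀ 𝔟, ∀ x ∈ cube N, g p 𝔟 x ∈ cube N := fun 𝔟 x hx => (hg p hp 𝔟 x hx).1
  have hMVg : MV η ε (g p) ℓ :=
    MV_of (F := f p₀) (M := M) (e := ec) hη0 hη1 hc hcD _ ℓ
      (fun 𝔟 x hx => (hg p hp 𝔟 x hx).2.1) hM hUU hUD hclD (by linarith)
  refine ⟨fun 𝔟 x hx y hy => hMVg.contr hη0.le hε.le hγ0.le (fun 𝔟 x hx => (hℓ 𝔟 x hx).2) 𝔟 hx hy,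
    fun w x hx y hy => ?_⟩
  have key : ∀ z ∈ cube N, lam hN f p₀ 𝔞₀ w z * ‖x - y‖ ≤
      Real.exp K₂ / c * Real.exp (ε' * w.length) * ‖psi g p w 𝔞 x - psi g p w 𝔞 y‖ := by
    intro z hz
    have e1 := expand_orbit hN hη0.le hη1 hκ0 hκ1 hec.le hC0 hC₁0 hθ0 hθ1 hγ'0 hε.le hε1 hf hgc
      hcon hcl0 hho hMVg (fun 𝔟 x hx => (hℓ 𝔟 x hx).1) hℓ2 hec1 w 𝔞 𝔞₀ 0 (by simp) hx hy hz
    rw [hlam w z hz]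
    have hl0 : 0 ≤ ll ℓ f p₀ w 𝔞₀ z :=
      le_trans (by positivity) (ll_bounds hγ'0 hf hℓ w 𝔞₀ hz).1
    have ht : 0 < 1 - θ := by linarith
    have hexp : (2 / γ') * (3 * ε * w.length + 2 * C₁ * ((1 - κ ^ w.length) / (1 - κ)) +
        (C₁ * (C / (1 - κ)) + C) * (θ ^ 0 / (1 - θ))) ≤ K₂ + ε' * w.length := by
      have b1 : (1 - κ ^ w.length) / (1 - κ) ≤ 1 / (1 - κ) := by
        gcongr
        have : 0 ≤ κ ^ w.length := by positivity
        linarith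
      calc _ ≤ (2 / γ') * (3 * ε * w.length + 2 * C₁ * (1 / (1 - κ)) +
            (C₁ * (C / (1 - κ)) + C) * (1 / (1 - θ))) := by
            rw [pow_zero]; gcongr
        _ = K₂ + (2 / γ') * (3 * ε) * w.length := by rw [hK₂]; ring
        _ ≤ _ := by gcongr
    have e2 := Real.exp_le_exp.2 hexp
    rw [Real.exp_add] at e2
    have e3 := DD_le hη0.le hη1 (psi g p w 𝔞 x - psi g p w 𝔞 y)
    have e4 := hcD (x - y)
    have e5 : ‖x - y‖ ≤ ‖DD N η (x - y)‖ / c := by rw [le_div_iff₀ hc, mul_comm]; exact e4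
    calc ll ℓ f p₀ w 𝔞₀ z * ‖x - y‖ ≤ ll ℓ f p₀ w 𝔞₀ z * (‖DD N η (x - y)‖ / c) := by gcongr
      _ = (ll ℓ f p₀ w 𝔞₀ z * ‖DD N η (x - y)‖) / c := by ring
      _ ≤ ((Real.exp K₂ * Real.exp (ε' * w.length)) * ‖psi g p w 𝔞 x - psi g p w 𝔞 y‖) / c := by
        refine div_le_div_of_nonneg_right ?_ hc.le
        exact e1.trans (mul_le_mul e2 e3 (norm_nonneg _) (by positivity))
      _ = _ := by ring
  rcases eq_or_ne x y with rfl | hxy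
  · simp
  · have hpos : 0 < ‖x - y‖ := norm_pos_iff.2 (sub_ne_zero.2 hxy)
    rw [← le_div_iff₀ hpos]
    refine csSup_le (hne.image _) ?_
    rintro _ ⟨z, hz, rfl⟩
    rw [le_div_iff₀ hpos]
    exact key z hz

lemma close_of_param {A : Type} {N d : ℕ} {r : ℕ∞} {hN : 0 < N} (hr : 2 ≤ r)
    {S : SkewFamily A N d r} {θ θ₀ : ℝ} {τ : ℕ} (hθ : θ ≤ θ₀) (Ft : ParamPerturb hN S θ τ)
    {t : E τ} (ht : t ∈ cubeO τ) {B : Set (E d)} (hB : B ⊆ cubeO d) :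
    Close S.f (Ft.g t) B θ₀ := by
  intro p hp 𝔟 x hx
  have hpP : p ∈ S.P' := S.P_subset (subset_closure (hB hp))
  have hxX : x ∈ S.X' := S.X_subset hx
  obtain ⟨θ', hθ', hcl⟩ := Ft.close
  have df := smooth_diff (h := fun p x => S.f p 𝔟 x) hr S.P'_open S.X'_open (S.smooth 𝔟) hpP hxX
  have dg := smooth_diff (h := fun p x => Ft.g t p 𝔟 x) hr S.P'_open S.X'_open
    (Ft.smooth t ht 𝔟) hpP hxX
  have sf := slice_fderiv (h := fun p x => S.f p 𝔟 x) df
  have sg := slice_fderiv (h := fun p x => Ft.g t p 𝔟 x) dg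
  refine ⟨Ft.into t ht 𝔟 p hpP ⟨x, hxX, rfl⟩, sg.differentiableAt, ?_, ?_⟩
  · have := hcl t ht 𝔟 0 (by simp) p hpP x hxX
    rw [norm_iteratedFDeriv_zero] at this
    simp only at this
    linarith
  · have h1 : ((1:ℕ) : ℕ∞) ≤ r := le_trans (by norm_num) hr
    have := hcl t ht 𝔟 1 h1 p hpP x hxX
    rw [norm_iteratedFDeriv_one, fderiv_fun_sub df dg] at this
    have e1 : fderiv ℝ (S.f p 𝔟) x - fderiv ℝ (Ft.g t p 𝔟) x =
        (fderiv ℝ (fun q : E d × E N => S.f q.1 𝔟 q.2) (p, x) -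
          fderiv ℝ (fun q : E d × E N => Ft.g t q.1 𝔟 q.2) (p, x)).comp
        (ContinuousLinearMap.inr ℝ (E d) (E N)) := by
      rw [show fderiv ℝ (S.f p 𝔟) x = _ from sf.fderiv,
        show fderiv ℝ (Ft.g t p 𝔟) x = _ from sg.fderiv, ContinuousLinearMap.sub_comp]
    rw [e1]
    refine (ContinuousLinearMap.opNorm_comp_le _ _).trans ?_
    have e2 : ‖ContinuousLinearMap.inr ℝ (E d) (E N)‖ ≤ 1 := by
      refine ContinuousLinearMap.opNorm_le_bound _ zero_le_one fun y => ?_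
      simp
    have e3 := mul_le_mul this e2 (norm_nonneg _) ((norm_nonneg _).trans this)
    linarith

lemma psi_cont {A : Type} {N d : ℕ} {r : ℕ∞} {hN : 0 < N}
    {S : SkewFamily A N d r} {θ : ℝ} {τ : ℕ} (Ft : ParamPerturb hN S θ τ)
    {B : Set (E d)} (hB : B ⊆ cubeO d) (w : List A) (𝔟 : ℕ → A) :
    ContinuousOn (fun q : E d × E τ => psi (Ft.g q.2) q.1 w 𝔟 0) (B ×ˢ cubeO τ) := by
  have hmem : ∀ q ∈ B ×ˢ cubeO τ, ∀ 𝔟 (w : List A), psi (Ft.g q.2) q.1 w 𝔟 0 ∈ cube N := by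
    intro q hq 𝔟 w
    refine psi_mem (fun 𝔟 x hx => ?_) w 𝔟 (zero_mem_cube N)
    exact Ft.into _ hq.2 𝔟 _ (S.P_subset (subset_closure (hB hq.1))) ⟨x, S.X_subset hx, rfl⟩
  induction w generalizing 𝔟 with
  | nil => exact continuousOn_const
  | cons a w ih =>
    have h1 := (Ft.jointSmooth (consF a 𝔟)).continuousOn
    have h2 : ContinuousOn (fun q : E d × E τ => ((q.2, q.1, psi (Ft.g q.2) q.1 w (consF a 𝔟) 0) :
        E τ × E d × E N)) (B ×ˢ cubeO τ) :=
      continuousOn_snd.prodMk (continuousOn_fst.prodMk (ih _))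
    exact h1.comp h2 fun q hq => ⟨hq.2, S.P_subset (subset_closure (hB hq.1)),
      S.X_subset (hmem q hq _ _)⟩

lemma mem_cyl_ofFn {A : Type} {n : ℕ} {w : Fin n → A} {β : ℕ → A} :
    β ∈ cyl (List.ofFn w) ↔ w = fun i : Fin n => β i := by
  simp only [cyl, mem_ofPred_eq]
  constructor
  · intro h
    funext i
    simpa using (h ⟨i, by simp⟩).symm
  · rintro rfl ⟨i, hi⟩
    simp

lemma meas_Phi {A : Type} [Finite A] [MeasurableSpace A] {N d τ : ℕ}
    {R : (ℕ → A) → (ℕ → A)} (hR : ∀ w : List A, MeasurableSet (R ⁻¹' cyl w))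
    {D : Set (E d × E τ)} (hD : MeasurableSet D) (Ψ : List A → E d × E τ → E N)
    (hΨ : ∀ w, ContinuousOn (Ψ w) D) (L : E d × E τ → (ℕ → A) → E N)
    (hL : ∀ q ∈ D, ∀ α, Tendsto (fun n => Ψ (trunc α n) q) atTop (𝓝 (L q α))) :
    Measurable (fun z : E d × E τ × (ℕ → A) =>
      D.indicator (fun q => L q (R z.2.2)) (z.1, z.2.1)) := by
  have : Fintype A := Fintype.ofFinite A
  classical
  refine measurable_of_tendsto_metrizable (f := fun n (z : E d × E τ × (ℕ → A)) =>
    ∑ w : Fin n → A, (R ⁻¹' cyl (List.ofFn w)).indicator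
      (fun _ => D.indicator (Ψ (List.ofFn w)) (z.1, z.2.1)) z.2.2) (fun n => ?_) ?_
  · refine Finset.measurable_sum _ fun w _ => ?_
    have m1 : Measurable (D.indicator (Ψ (List.ofFn w))) := by
      have := (hΨ (List.ofFn w)).measurable_piecewise (g := fun _ => 0) continuousOn_const hD
      rwa [show (fun _ : E d × E τ => (0 : E N)) = 0 from rfl, piecewise_eq_indicator] at this
    have m2 : Measurable (fun z : E d × E τ × (ℕ → A) =>
      D.indicator (Ψ (List.ofFn w)) (z.1, z.2.1)) := m1.comp (by fun_prop)
    have m3 : MeasurableSet ((fun z : E d × E τ × (ℕ → A) => z.2.2) ⁻¹' (R ⁻¹' cyl (List.ofFn w))) :=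
      (hR _).preimage (by fun_prop)
    exact m2.indicator m3
  · rw [tendsto_pi_nhds]
    intro z
    have hs : ∀ n, ∑ w : Fin n → A, (R ⁻¹' cyl (List.ofFn w)).indicator
      (fun _ => D.indicator (Ψ (List.ofFn w)) (z.1, z.2.1)) z.2.2 =
        D.indicator (Ψ (trunc (R z.2.2) n)) (z.1, z.2.1) := by
      intro n
      rw [Finset.sum_eq_single (fun i : Fin n => R z.2.2 i)]
      · rw [indicator_of_mem]
        · rfl
        · exact mem_cyl_ofFn.2 rfl
      · intro w _ hw
        rw [indicator_of_notMem]
        intro h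
        exact hw (mem_cyl_ofFn.1 h)
      · simp
    simp_rw [hs]
    by_cases hz : (z.1, z.2.1) ∈ D
    · simp only [indicator_of_mem hz]
      exact hL _ hz _
    · simp only [indicator_of_notMem hz]
      exact tendsto_const_nhds


lemma tsum_lists {A : Type} [Fintype A] (m : List A → ℝ≥0∞)
    (hm : ∀ n : ℕ, ∑ w : Fin n → A, m (List.ofFn w) ≤ 1) {ρ : ℝ} (h0 : 0 ≤ ρ) (h1 : ρ < 1) :
    ∑' w : List A, m w * ENNReal.ofReal (ρ ^ w.length) < ⊤ := by
  have e1 : ∑' w : List A, m w * ENNReal.ofReal (ρ ^ w.length) =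
      ∑' n : ℕ, ∑' w : Fin n → A, m (List.ofFn w) * ENNReal.ofReal (ρ ^ n) := by
    rw [← (List.equivSigmaTuple (α := A)).symm.tsum_eq, ENNReal.tsum_sigma']
    refine tsum_congr fun n => tsum_congr fun w => ?_
    have : (List.equivSigmaTuple (α := A)).symm ⟨n, w⟩ = List.ofFn w := rfl
    rw [this, List.length_ofFn]
  rw [e1]
  calc _ ≤ ∑' n : ℕ, ENNReal.ofReal (ρ ^ n) := by
        refine ENNReal.tsum_le_tsum fun n => ?_
        rw [tsum_fintype, ← Finset.sum_mul]
        calc _ ≤ 1 * ENNReal.ofReal (ρ ^ n) := by gcongr; exact hm n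
          _ = _ := one_mul _
    _ = ENNReal.ofReal (∑' n : ℕ, ρ ^ n) :=
        (ENNReal.ofReal_tsum_of_nonneg (fun n => by positivity)
          (summable_geometric_of_lt_one h0 h1)).symm
    _ < ⊤ := ENNReal.ofReal_lt_top

lemma sum_meas_cyl {A : Type} [Fintype A] [MeasurableSpace A] {R : (ℕ → A) → (ℕ → A)}
    (hR : ∀ w : List A, MeasurableSet (R ⁻¹' cyl w)) (μ : Measure (ℕ → A)) [IsProbabilityMeasure μ]
    (n : ℕ) : ∑ w : Fin n → A, μ (R ⁻¹' cyl (List.ofFn w)) ≤ 1 := by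
  classical
  rw [← measure_biUnion_finset _ (fun w _ => hR _)]
  · exact prob_le_one
  · intro w _ v _ hwv
    refine Set.disjoint_left.2 fun α h1 h2 => hwv ?_
    rw [mem_cyl_ofFn.1 h1, mem_cyl_ofFn.1 h2]

lemma sum_finite {A : Type} [Fintype A] [MeasurableSpace A] {R : (ℕ → A) → (ℕ → A)}
    (hR : ∀ w : List A, MeasurableSet (R ⁻¹' cyl w))
    (hR2 : ∀ s : Set (ℕ → A), MeasurableSet s → R ⁻¹' s = s)
    (μ : Measure (ℕ → A)) [IsProbabilityMeasure μ] (N : ℕ)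
    (Lm : List A → ℝ) {γ ε D C C' K : ℝ} (hL : ∀ w, 0 < Lm w ∧ Lm w ≤ γ ^ w.length)
    (hγ : 0 < γ) (hD : (N:ℝ) < D) (hC : 0 < C) (hC' : 0 < C') (hK : 0 < K)
    (hμ : ∀ w, μ (cyl w) ≤ ENNReal.ofReal (C' * Lm w ^ D))
    (hρ : γ ^ (D - N) * Real.exp (ε * N) < 1) :
    ∑' w : List A, μ (R ⁻¹' cyl w) * μ (R ⁻¹' cyl w) *
      ENNReal.ofReal (C * (K * Real.exp (ε * w.length) / Lm w) ^ N) < ⊤ := by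
  set ρ := γ ^ (D - N) * Real.exp (ε * N) with hρd
  have hρ0 : 0 ≤ ρ := by positivity
  set Q := C' * (C * K ^ N) with hQ
  have key : ∀ w : List A, μ (R ⁻¹' cyl w) * μ (R ⁻¹' cyl w) *
      ENNReal.ofReal (C * (K * Real.exp (ε * w.length) / Lm w) ^ N) ≤
      ENNReal.ofReal Q * (μ (R ⁻¹' cyl w) * ENNReal.ofReal (ρ ^ w.length)) := by
    intro w
    obtain ⟨l0, l1⟩ := hL w
    have a1 : μ (R ⁻¹' cyl w) ≤ ENNReal.ofReal (C' * Lm w ^ D) :=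
      (measure_R_cyl hR2 μ _).trans (hμ w)
    have a2 : (C' * Lm w ^ D) * (C * (K * Real.exp (ε * w.length) / Lm w) ^ N) ≤
        Q * ρ ^ w.length := by
      have b1 : Lm w ^ D = Lm w ^ (D - N) * Lm w ^ N := by
        rw [← Real.rpow_natCast (Lm w) N, ← Real.rpow_add l0]; congr 1; ring
      have b2 : Lm w ^ (D - N) ≤ (γ ^ (D - N)) ^ w.length := by
        calc Lm w ^ (D - N) ≤ (γ ^ w.length) ^ (D - N) :=
              Real.rpow_le_rpow l0.le l1 (by linarith)
          _ = _ := by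
              rw [← Real.rpow_natCast, ← Real.rpow_natCast, ← Real.rpow_mul hγ.le,
                ← Real.rpow_mul hγ.le, mul_comm]
      have b3 : Real.exp (ε * w.length) ^ N = Real.exp (ε * N) ^ w.length := by
        rw [← Real.exp_nat_mul, ← Real.exp_nat_mul]; congr 1; ring
      have b4 : Lm w ^ N ≠ 0 := by positivity
      calc _ = Q * (Lm w ^ (D - N) * Real.exp (ε * w.length) ^ N) := by
            rw [b1, hQ, div_pow, mul_pow]; field_simp
        _ ≤ Q * ((γ ^ (D - N)) ^ w.length * Real.exp (ε * N) ^ w.length) := by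
            rw [b3]; gcongr
        _ = _ := by rw [hρd, mul_pow]
    calc _ ≤ μ (R ⁻¹' cyl w) * ENNReal.ofReal (C' * Lm w ^ D) *
          ENNReal.ofReal (C * (K * Real.exp (ε * w.length) / Lm w) ^ N) := by gcongr
      _ = μ (R ⁻¹' cyl w) * ENNReal.ofReal ((C' * Lm w ^ D) *
          (C * (K * Real.exp (ε * w.length) / Lm w) ^ N)) := by
          rw [mul_assoc, ← ENNReal.ofReal_mul (by positivity)]
      _ ≤ μ (R ⁻¹' cyl w) * ENNReal.ofReal (Q * ρ ^ w.length) := by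
          gcongr
      _ = _ := by rw [ENNReal.ofReal_mul (by positivity)]; ring
  refine (ENNReal.tsum_le_tsum key).trans_lt ?_
  rw [ENNReal.tsum_mul_left]
  exact ENNReal.mul_lt_top ENNReal.ofReal_lt_top
    (tsum_lists _ (sum_meas_cyl hR μ) hρ0 hρ)

/-- The pair estimate. -/
lemma pair_est {A : Type} {N d : ℕ} (lB : Measure (E d)) (π : (ℕ → A) → E d → E N)
    (h : List A → ℝ) (hh : ∀ w, 1 ≤ h w) {C : ℝ} (hC : 0 < C)
    (hest : ∀ (α β : ℕ → A) (w : List A), α ∈ cyl w → β ∈ cyl w → α w.length ≠ β w.length →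
      ∀ r > (0:ℝ), lB {p | dist (π α p) (π β p) < r} ≤ ENNReal.ofReal (C * (r * h w) ^ N))
    (α β : ℕ → A) (r : ℝ) (hr : 0 < r) :
    lB {p | dist (π α p) (π β p) < r} ≤ ∑' w : List A, (cyl w).indicator 1 α *
      (cyl w).indicator 1 β * ENNReal.ofReal (C * (r * h w) ^ N) := by
  classical
  rcases eq_or_ne α β with rfl | hne
  · have hinj : Function.Injective (trunc α) := fun m n hmn => by
      simpa [trunc] using congrArg List.length hmn
    refine le_trans ?_ (ENNReal.tsum_comp_le_tsum_of_injective hinj _)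
    have hlb : ∀ n, ENNReal.ofReal (C * r ^ N) ≤ (cyl (trunc α n)).indicator 1 α *
      (cyl (trunc α n)).indicator 1 α * ENNReal.ofReal (C * (r * h (trunc α n)) ^ N) := by
      intro n
      have : α ∈ cyl (trunc α n) := mem_cyl_trunc.2 fun _ _ => rfl
      rw [indicator_of_mem this]
      simp only [Pi.one_apply, one_mul]
      apply ENNReal.ofReal_le_ofReal
      have := hh (trunc α n)
      gcongr
      nlinarith
    refine le_trans ?_ (ENNReal.tsum_le_tsum hlb)
    rw [ENNReal.tsum_const_eq_top_of_ne_zero]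
    · exact le_top
    · have : 0 < C * r ^ N := by positivity
      simpa using this
  · have hex : ∃ n, α n ≠ β n := by
      by_contra hcon
      push Not at hcon
      exact hne (funext hcon)
    set n := Nat.find hex with hn
    have h1 : α n ≠ β n := Nat.find_spec hex
    have h2 : ∀ i < n, β i = α i := fun i hi => by
      have := Nat.find_min hex hi
      push Not at this
      exact this.symm
    have ha : α ∈ cyl (trunc α n) := mem_cyl_trunc.2 fun _ _ => rfl
    have hb : β ∈ cyl (trunc α n) := mem_cyl_trunc.2 h2
    have hl : (trunc α n).length = n := by simp [trunc]
    refine (hest α β (trunc α n) ha hb (by rw [hl]; exact h1) r hr).trans ?_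
    refine le_trans ?_ (ENNReal.le_tsum (trunc α n))
    rw [indicator_of_mem ha, indicator_of_mem hb]
    simp

lemma integrate_est {A : Type} [Finite A] [MeasurableSpace A] {N d : ℕ} (lB : Measure (E d))
    {R : (ℕ → A) → (ℕ → A)} (hR : ∀ w : List A, MeasurableSet (R ⁻¹' cyl w))
    (μ : Measure (ℕ → A)) (π : (ℕ → A) → E d → E N)
    (h : List A → ℝ) (hh : ∀ w, 1 ≤ h w) {C : ℝ} (hC : 0 < C)
    (hest : ∀ (α β : ℕ → A) (w : List A), α ∈ cyl w → β ∈ cyl w → α w.length ≠ β w.length →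
      ∀ r > (0:ℝ), lB {p | dist (π α p) (π β p) < r} ≤ ENNReal.ofReal (C * (r * h w) ^ N))
    (r : ℝ) (hr : 0 < r) :
    ∫⁻ ω, ∫⁻ ω', lB {p | dist (π (R ω') p) (π (R ω) p) < r} ∂μ ∂μ ≤
      ENNReal.ofReal (r ^ N) * ∑' w : List A, μ (R ⁻¹' cyl w) * μ (R ⁻¹' cyl w) *
      ENNReal.ofReal (C * (h w) ^ N) := by
  have mi : ∀ w : List A, Measurable ((R ⁻¹' cyl w).indicator (1 : (ℕ → A) → ℝ≥0∞)) :=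
    fun w => measurable_one.indicator (hR w)
  calc _ ≤ ∫⁻ ω, ∫⁻ ω', ∑' w : List A, (R ⁻¹' cyl w).indicator 1 ω' *
      (R ⁻¹' cyl w).indicator 1 ω * ENNReal.ofReal (C * (r * h w) ^ N) ∂μ ∂μ :=
        lintegral_mono fun ω => lintegral_mono fun ω' =>
          pair_est lB π h hh hC hest (R ω') (R ω) r hr
    _ = ∫⁻ ω, ∑' w : List A, μ (R ⁻¹' cyl w) * (R ⁻¹' cyl w).indicator 1 ω *
        ENNReal.ofReal (C * (r * h w) ^ N) ∂μ := by
        refine lintegral_congr fun ω => ?_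
        rw [lintegral_tsum]
        · refine tsum_congr fun w => ?_
          simp_rw [mul_assoc]
          rw [lintegral_mul_const _ (mi w), lintegral_indicator_one (hR w)]
        · exact fun w => (((mi w).mul_const _).mul_const _).aemeasurable
    _ = ∑' w : List A, μ (R ⁻¹' cyl w) * μ (R ⁻¹' cyl w) *
        ENNReal.ofReal (C * (r * h w) ^ N) := by
        rw [lintegral_tsum]
        · refine tsum_congr fun w => ?_
          rw [lintegral_mul_const _ ((mi w).const_mul _), lintegral_const_mul _ (mi w),
            lintegral_indicator_one (hR w)]
        · exact fun w => (((mi w).const_mul _).mul_const _).aemeasurable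
    _ = _ := by
        rw [← ENNReal.tsum_mul_left]
        refine tsum_congr fun w => ?_
        rw [mul_pow, show C * (r ^ N * h w ^ N) = r ^ N * (C * h w ^ N) by ring,
          ENNReal.ofReal_mul (by positivity)]
        ring


lemma cubeO_vol (τ : ℕ) : volume (cubeO τ) < ⊤ :=
  (measure_mono (cubeO_sub τ)).trans_lt (cube_compact τ).measure_lt_top

/-- Constant family. -/
def constFam {A : Type} {N d : ℕ} {r : ℕ∞} (hN : 0 < N) (S : SkewFamily A N d r)
    (hU : UnipOn hN S.f S.P' S.X') {θ : ℝ} (hθ : 0 < θ) (τ : ℕ) : ParamPerturb hN S θ τ where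
  g := fun _ => S.f
  jointSmooth := fun 𝔟 => (S.smooth 𝔟).comp contDiff_snd.contDiffOn fun _ hq => hq.2
  smooth := fun _ _ 𝔟 => S.smooth 𝔟
  inj := fun _ _ => S.inj
  into := fun _ _ => S.into
  close := ⟨0, hθ, fun t _ 𝔟 k _ p _ x _ => by
    have : (fun q : E d × E N => S.f q.1 𝔟 q.2 - S.f q.1 𝔟 q.2) = 0 := by
      funext q; simp
    rw [this, iteratedFDeriv_zero]
    simp⟩
  unip := fun _ _ => hU

lemma exists_eps {γ s : ℝ} (N : ℕ) (h0 : 0 < γ) (h1 : γ < 1) (hs : 0 < s) :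
    ∃ ε > 0, γ ^ s * Real.exp (ε * N) < 1 := by
  have hl : Real.log γ < 0 := Real.log_neg h0 h1
  have hp : 0 < - (s * Real.log γ) := by nlinarith
  refine ⟨- (s * Real.log γ) / (N + 1), by positivity, ?_⟩
  rw [Real.rpow_def_of_pos h0, ← Real.exp_add, Real.exp_lt_one_iff]
  have : - (s * Real.log γ) / (N + 1) * N < - (s * Real.log γ) := by
    rw [div_mul_eq_mul_div, div_lt_iff₀ (by positivity)]
    nlinarith
  nlinarith


/-- Proposition: finiteness of the density integrals. -/
theorem proposition_lilou {A : Type} [Fintype A] [MeasurableSpace A] {N d : ℕ} {r : ℕ∞}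
    (hA : 2 ≤ Fintype.card A) (hN : 0 < N) (hd : 0 < d) (hr : 2 ≤ r)
    (S : SkewFamily A N d r)
    (hU : UnipOn hN S.f S.P' S.X')
    (γ' γ : ℝ) (hγ : GammaBounds hN S.f γ' γ)
    (hT : TransAssumption hN S)
    (Δ : E d → ℝ)
    (hΔzero : ∀ p ∈ closure (cubeO d), 0 ≤ Δ p ∧ ∀ 𝔞 : ℕ → A, pressure S.f p 𝔞 (Δ p) = 0)
    (hΔ : ∀ p ∈ closure (cubeO d), (N : ℝ) < Δ p)
    (p₀ : E d) (hp₀ : p₀ ∈ cubeO d) (𝔞 𝔞₀ : ℕ → A)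
    (μ : Measure (ℕ → A)) [IsProbabilityMeasure μ]
    (c C' : ℝ) (hc : 0 < c) (hcC : c ≤ C')
    (hμ : ∀ w : List A,
      ENNReal.ofReal (c * Lam hN S.f p₀ 𝔞₀ w ^ Δ p₀) ≤ μ (cyl w) ∧
      μ (cyl w) ≤ ENNReal.ofReal (C' * Lam hN S.f p₀ 𝔞₀ w ^ Δ p₀)) :
    ∃ δ > (0:ℝ), Metric.ball p₀ δ ⊆ cubeO d ∧
      (∫⁻ p in Metric.ball p₀ δ,
        ∫⁻ x, dens (Measure.map (piProj S.f p 𝔞) μ) x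
          ∂(Measure.map (piProj S.f p 𝔞) μ)) < ⊤ ∧
      ∃ θ₀ > (0:ℝ), ∀ τ : ℕ, 0 < τ → ∀ Ft : ParamPerturb hN S θ₀ τ,
        (∫⁻ p in Metric.ball p₀ δ, ∫⁻ t in cubeO τ,
          ∫⁻ x, dens (Measure.map (piProj (Ft.g t) p 𝔞) μ) x
            ∂(Measure.map (piProj (Ft.g t) p 𝔞) μ)) < ⊤ := by
  classical
  have hAne : Nonempty A := Fintype.card_pos_iff.1 (by omega)
  have hcl₀ : p₀ ∈ closure (cubeO d) := subset_closure hp₀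
  obtain ⟨hγ'0, hγ'γ, hγ1, -⟩ := id hγ
  have hγ0 : 0 < γ := hγ'0.trans hγ'γ
  have hC'0 : 0 < C' := hc.trans_le hcC
  obtain ⟨ε, hε, hρ⟩ := exists_eps N hγ0 hγ1 (sub_pos.2 (hΔ p₀ hcl₀))
  obtain ⟨hLam, δ, hδ, hBsub, θ₁, hθ₁, η, κ, K, hη0, hη1, hκ0, hκ1, hK, hsys⟩ :=
    system_const hN hr S hU γ' γ hγ p₀ hp₀ 𝔞 𝔞₀ ε hε
  obtain ⟨C, hC, -, θ₂, hθ₂, hTr⟩ := hT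
  obtain ⟨R, hR, hR2⟩ := exists_R (A := A)
  set K' := max K 1 with hK'
  have hK'0 : 0 < K' := hK.trans_le (le_max_left _ _)
  have hθ : 0 < min θ₁ θ₂ := lt_min hθ₁ hθ₂
  let h : List A → ℝ := fun w => K' * Real.exp (ε * w.length) / Lam hN S.f p₀ 𝔞₀ w
  have hh : ∀ w, 1 ≤ h w := by
    intro w
    obtain ⟨l0, l1⟩ := hLam w
    rw [one_le_div l0]
    have e1 : Lam hN S.f p₀ 𝔞₀ w ≤ 1 := l1.trans (pow_le_one₀ hγ0.le hγ1.le)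
    have e2 : 1 ≤ Real.exp (ε * w.length) := Real.one_le_exp (by positivity)
    have e3 : 1 ≤ K' := le_max_right _ _
    nlinarith
  have hfin := sum_finite hR hR2 μ N (Lam hN S.f p₀ 𝔞₀) hLam hγ0 (hΔ p₀ hcl₀) hC hC'0 hK'0
    (fun w => (hμ w).2) hρ
  have key : ∀ τ : ℕ, 0 < τ → ∀ Ft : ParamPerturb hN S (min θ₁ θ₂) τ,
        (∫⁻ p in Metric.ball p₀ δ, ∫⁻ t in cubeO τ,
          ∫⁻ x, dens (Measure.map (piProj (Ft.g t) p 𝔞) μ) x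
            ∂(Measure.map (piProj (Ft.g t) p 𝔞) μ)) < ⊤ := by
    intro τ hτ Ft
    have hTm : MeasurableSet (cubeO τ) := (cubeO_open τ).measurableSet
    have hBm : MeasurableSet (Metric.ball p₀ δ) := measurableSet_ball
    set D : Set (E d × E τ) := Metric.ball p₀ δ ×ˢ cubeO τ with hD
    have hDm : MeasurableSet D := hBm.prod hTm
    have hcl : ∀ t ∈ cubeO τ, Close S.f (Ft.g t) (Metric.ball p₀ δ) θ₁ := fun t ht =>
      close_of_param hr (min_le_left _ _) Ft ht hBsub
    have hcon : ∀ t ∈ cubeO τ, ∀ p ∈ Metric.ball p₀ δ, ∀ 𝔟, ∀ x ∈ cube N, ∀ y ∈ cube N,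
        ‖DD N η (Ft.g t p 𝔟 x - Ft.g t p 𝔟 y)‖ ≤ κ * ‖DD N η (x - y)‖ := fun t ht p hp =>
      (hsys _ (hcl t ht) p hp).1
    have hgc : ∀ t ∈ cubeO τ, ∀ p ∈ Metric.ball p₀ δ, ∀ 𝔟, ∀ x ∈ cube N,
        Ft.g t p 𝔟 x ∈ cube N := fun t ht p hp 𝔟 x hx => (hcl t ht p hp 𝔟 x hx).1
    have hgd : ∀ t ∈ cubeO τ, ∀ p ∈ Metric.ball p₀ δ, ∀ 𝔟, ∀ x ∈ cube N,
        DifferentiableAt ℝ (Ft.g t p 𝔟) x := fun t ht p hp 𝔟 x hx => (hcl t ht p hp 𝔟 x hx).2.1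
    have hΦ := meas_Phi hR hDm (fun w (q : E d × E τ) => psi (Ft.g q.2) q.1 w 𝔞 0)
      (fun w => psi_cont Ft hBsub w 𝔞) (fun q α => piProj (Ft.g q.2) q.1 𝔞 α)
      (fun q hq α => tendsto_piProj hη0 hη1 hκ0 hκ1 (hgc q.2 hq.2 q.1 hq.1)
        (hcon q.2 hq.2 q.1 hq.1) 𝔞 α)
    have hTfin : IsFiniteMeasure ((volume : Measure (E τ)).restrict (cubeO τ)) :=
      ⟨by rw [Measure.restrict_apply_univ]; exact cubeO_vol τ⟩
    have main := meas_main ((volume : Measure (E d)).restrict (Metric.ball p₀ δ))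
      ((volume : Measure (E τ)).restrict (cubeO τ)) μ hN _ hΦ _ hfin.ne (by
        refine ae_restrict_of_forall_mem hTm fun t ht r hr => ?_
        refine integrate_est _ hR μ
          (fun α p => D.indicator (fun q => piProj (Ft.g q.2) q.1 𝔞 α) (p, t)) h hh hC ?_ r hr
        intro α β w hα hβ hαβ r hr
        rw [Measure.restrict_apply' hBm]
        have hw := hh w
        refine le_trans (measure_mono ?_) (hTr (min θ₁ θ₂) hθ (min_le_right _ _) τ hτ Ft t ht
          (app w 𝔞) (fun i => α (i + w.length)) (fun i => β (i + w.length)) (by simpa using hαβ)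
          (r * h w) (by positivity))
        rintro p ⟨hp1, hp2⟩
        refine ⟨hBsub hp2, ?_⟩
        have hmem : (p, t) ∈ D := ⟨hp2, ht⟩
        simp only [mem_ofPred_eq, indicator_of_mem hmem] at hp1
        rw [piProj_cyl hη0 hη1 hκ0 hκ1 (hgc t ht p hp2) (hgd t ht p hp2) (hcon t ht p hp2) w 𝔞 α hα,
          piProj_cyl hη0 hη1 hκ0 hκ1 (hgc t ht p hp2) (hgd t ht p hp2) (hcon t ht p hp2) w 𝔞 β hβ,
          dist_eq_norm] at hp1
        have e1 := (hsys _ (hcl t ht) p hp2).2 w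
          (piProj (Ft.g t) p (app w 𝔞) (fun i => α (i + w.length)))
          (piProj_mem hη0 hη1 hκ0 hκ1 (hgc t ht p hp2) (hcon t ht p hp2) _ _)
          (piProj (Ft.g t) p (app w 𝔞) (fun i => β (i + w.length)))
          (piProj_mem hη0 hη1 hκ0 hκ1 (hgc t ht p hp2) (hcon t ht p hp2) _ _)
        have l0 := (hLam w).1
        have e2 : K * Real.exp (ε * w.length) ≤ K' * Real.exp (ε * w.length) := by
          gcongr
          exact le_max_left _ _
        simp only [h]
        rw [mul_div_assoc', lt_div_iff₀ l0, mul_comm _ (Lam hN S.f p₀ 𝔞₀ w)]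
        refine e1.trans_lt ?_
        calc _ ≤ K' * Real.exp (ε * w.length) * _ := mul_le_mul_of_nonneg_right e2 (norm_nonneg _)
          _ < K' * Real.exp (ε * w.length) * r := by gcongr
          _ = _ := by ring)
    refine lt_of_le_of_lt ?_ main
    refine setLIntegral_mono' hBm fun p hp => setLIntegral_mono' hTm fun t ht => ?_
    have hmem : (p, t) ∈ D := ⟨hp, ht⟩
    simp only [indicator_of_mem hmem]
    exact integral_le_R hR2 μ (piProj (Ft.g t) p 𝔞)
  refine ⟨δ, hδ, hBsub, ?_, min θ₁ θ₂, hθ, key⟩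
  have k1 := key 1 one_pos (constFam hN S hU hθ 1)
  have hv0 : volume (cubeO 1) ≠ 0 := by
    refine ((cubeO_open 1).measure_pos volume ⟨0, fun i => ?_⟩).ne'
    simp
  have hvt : volume (cubeO 1) ≠ ⊤ := (cubeO_vol 1).ne
  simp only [constFam, lintegral_const, Measure.restrict_apply_univ] at k1
  rw [lintegral_mul_const' _ _ hvt] at k1
  by_contra hcon
  rw [not_lt, top_le_iff] at hcon
  rw [hcon, ENNReal.top_mul hv0] at k1
  exact lt_irrefl _ k1


end Paper
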